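/- arXiv:2302.10263 — 17 statements merged into one kernel-verified Lean document; each statement's English description precedes it below -/
import Mathlib

section
/- Let S be a semigroup, σ : S → S an automorphism, f : S → ℂ a nonzero function and β ∈ ℂ \ {0} a constant such that f(x·σ(y)) = β·f(x)·f(y) for all x, y ∈ S. Then the function χ := β·f is a nonzero multiplicative function on S and χ ∘ σ = χ. -/
open Complex

theorem stmt_0 {S : Type*} [Semigroup S] (σ : S → S)
    (hσbij : Function.Bijective σ)
    (hσmul : ∀ x y : S, σ (x * y) = σ x * σ y)
    (f : S → ℂ) (hf : f ≠ 0) (β : ℂ) (hβ : β ≠ 0)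
    (heq : ∀ x y : S, f (x * σ y) = β * f x * f y) :
    (fun x => β * f x) ≠ 0 ∧
    (∀ x y : S, β * f (x * y) = (β * f x) * (β * f y)) ∧
    (∀ x : S, β * f (σ x) = β * f x) := by
  obtain ⟨a, ha⟩ := Function.ne_iff.mp hf
  have ha : f a ≠ 0 := ha
  have hinv : ∀ x, f (σ x) = f x := by
    intro x
    have h : f (a * σ a * σ (σ x)) = f (a * σ (a * σ x)) := by rw [hσmul, mul_assoc]
    rw [heq, heq, heq, heq] at h
    have hc : β * β * f a * f a ≠ 0 := by simp [hβ, ha]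
    exact mul_left_cancel₀ hc (by linear_combination h)
  refine ⟨fun h => mul_ne_zero hβ ha (congrFun h a), fun x y => ?_, fun x => by rw [hinv]⟩
  obtain ⟨z, rfl⟩ := hσbij.surjective y
  rw [heq, hinv]
  ring
end

section
/- Let S be a semigroup and σ : S → S an automorphism. Suppose f, g : S → ℂ satisfy g(x·σ(y)) = g(x)g(y) + f(x)f(y) for all x, y ∈ S, and suppose f and g are linearly independent. Then g ∘ σ = g, and either f ∘ σ = f or f ∘ σ = −f. -/
open Complex

/-- Addition-type formulas for `g` and `f` following from the cosine subtraction law with an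
endomorphism. -/
lemma exists_addition_formulas {S : Type*} [Semigroup S] {σ : S → S}
    (hσmul : ∀ x y : S, σ (x * y) = σ x * σ y) {f g : S → ℂ}
    (heq : ∀ x y : S, g (x * σ y) = g x * g y + f x * f y)
    (hindep : ∀ a b : ℂ, (∀ x : S, a * f x + b * g x = 0) → a = 0 ∧ b = 0)
    {z₀ : S} (hz₀ : f z₀ ≠ 0) :
    ∃ A B : S → ℂ, (∀ x y, f (x * σ y) = g x * A y + f x * B y) ∧
      (∀ y z, g (y * z) = g y * g z + A y * f z) ∧
      (∀ y z, f (y * z) = f y * g z + B y * f z) := by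
  have key (x y z : S) :
      g x * g (y * z) + f x * f (y * z) = (g x * g y + f x * f y) * g z + f (x * σ y) * f z := by
    rw [← heq, ← heq, ← heq, hσmul, mul_assoc]
  let A : S → ℂ := fun y ↦ (g (y * z₀) - g y * g z₀) / f z₀
  let B : S → ℂ := fun y ↦ (f (y * z₀) - f y * g z₀) / f z₀
  have hf (x y : S) : f (x * σ y) = g x * A y + f x * B y := by
    simp only [A, B]
    field_simp
    linear_combination -key x y z₀
  have hcoeff (y z : S) := hindep (f (y * z) - f y * g z - B y * f z)
    (g (y * z) - g y * g z - A y * f z) fun x ↦ by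
      linear_combination key x y z + f z * hf x y
  exact ⟨A, B, hf, fun y z ↦ by linear_combination (hcoeff y z).2,
    fun y z ↦ by linear_combination (hcoeff y z).1⟩

theorem stmt_1 {S : Type*} [Semigroup S] (σ : S → S)
    (hσbij : Function.Bijective σ)
    (hσmul : ∀ x y : S, σ (x * y) = σ x * σ y)
    (f g : S → ℂ)
    (heq : ∀ x y : S, g (x * σ y) = g x * g y + f x * f y)
    (hindep : ∀ a b : ℂ, (∀ x : S, a * f x + b * g x = 0) → a = 0 ∧ b = 0) :
    (∀ x : S, g (σ x) = g x) ∧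
    ((∀ x : S, f (σ x) = f x) ∨ (∀ x : S, f (σ x) = -f x)) := by
  obtain ⟨z₀, hz₀⟩ : ∃ z, f z ≠ 0 := by
    by_contra! h
    exact one_ne_zero (hindep 1 0 (by simp [h])).1
  obtain ⟨A, B, hf, hgmul, hfmul⟩ := exists_addition_formulas hσmul heq hindep hz₀
  obtain ⟨z₁, rfl⟩ := hσbij.surjective z₀
  have hgσ (y z : S) : g y * g (σ z) + A y * f (σ z) = g y * g z + f y * f z := by
    rw [← hgmul, heq]
  have hfσ (y z : S) : f y * g (σ z) + B y * f (σ z) = g y * A z + f y * B z := by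
    rw [← hfmul, hf]
  obtain ⟨a, b, hA⟩ : ∃ a b : ℂ, ∀ y, A y = a * g y + b * f y := by
    refine ⟨(g z₁ - g (σ z₁)) / f (σ z₁), f z₁ / f (σ z₁), fun y ↦ ?_⟩
    field_simp
    linear_combination hgσ y z₁
  obtain ⟨c, d, hB⟩ : ∃ c d : ℂ, ∀ y, B y = c * g y + d * f y := by
    refine ⟨A z₁ / f (σ z₁), (B z₁ - g (σ z₁)) / f (σ z₁), fun y ↦ ?_⟩
    field_simp
    linear_combination hfσ y z₁
  have hg_coeff (z : S) := hindep (b * f (σ z) - f z) (g (σ z) + a * f (σ z) - g z) fun y ↦ by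
    linear_combination hgσ y z - f (σ z) * hA y
  have hf_coeff (z : S) := hindep (g (σ z) + d * f (σ z) - B z) (c * f (σ z) - A z) fun y ↦ by
    linear_combination hfσ y z - f (σ z) * hB y
  have hfb (z : S) : f z = b * f (σ z) := by linear_combination -(hg_coeff z).1
  have hb : b ≠ 0 := by
    rintro rfl
    exact hz₀ (by simpa using hfb (σ z₁))
  obtain ⟨hcb, hba⟩ := hindep (c - b * b) (-(b * a)) fun z ↦ by
    linear_combination b * (hf_coeff z).2 + b * hA z + c * hfb z
  have ha : a = 0 := by simpa [hb] using hba
  have hg (z : S) : g (σ z) = g z := by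
    linear_combination (hg_coeff z).2 - f (σ z) * ha
  obtain ⟨-, hc⟩ := hindep (d - b * d) (b * (1 - c)) fun z ↦ by
    linear_combination b * (hf_coeff z).1 + b * hB z + d * hfb z - b * hg z
  have hc1 : c = 1 := by
    linear_combination -((mul_eq_zero.mp hc).resolve_left hb)
  have hb2 : b * b = 1 := by linear_combination hc1 - hcb
  refine ⟨hg, (mul_self_eq_one_iff.mp hb2).imp (fun h z ↦ ?_) (fun h z ↦ ?_)⟩
  · linear_combination -hfb z - f (σ z) * h
  · linear_combination hfb z + f (σ z) * h
end

section
/- Let S be a semigroup and σ : S → S an automorphism. Suppose f, g : S → ℂ satisfy the variant equation g(σ(y)·x) = g(x)g(y) + f(x)f(y) for all x, y ∈ S, and suppose f and g are linearly independent. Then g ∘ σ = g, and either f ∘ σ = f or f ∘ σ = −f. -/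
open Complex

namespace SineAdditionVariant

variable {S : Type*} [Semigroup S] {σ τ : S → S} {f g : S → ℂ}

/-- Under the variant equation, `f` and `g` stay linearly independent on the set of products. -/
theorem indep_on_products
    (hτσ : ∀ x, τ (σ x) = x) (hτmul : ∀ x y : S, τ (x * y) = τ x * τ y)
    (hprod : ∀ x y : S, g (x * y) = g (τ x) * g y + f (τ x) * f y)
    (hindep : ∀ a b : ℂ, (∀ x : S, a * f x + b * g x = 0) → a = 0 ∧ b = 0)
    (α β : ℂ) (h : ∀ x y : S, α * f (x * y) + β * g (x * y) = 0) : α = 0 ∧ β = 0 := by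
  have hτindep : ∀ a b : ℂ, (∀ x : S, a * f (τ x) + b * g (τ x) = 0) → a = 0 ∧ b = 0 :=
    fun a b hab => hindep a b fun x => by simpa [hτσ] using hab (σ x)
  have hg : ¬ ∀ x y : S, g (x * y) = 0 := by
    intro hz
    have hv : ∀ x, f (τ x) = 0 ∧ g (τ x) = 0 := fun x =>
      hindep _ _ fun y => by linear_combination hz x y - hprod x y
    exact one_ne_zero (hτindep 1 1 fun x => by simp [hv x]).1
  by_cases hα : α = 0
  · refine ⟨hα, by_contra fun hβ => hg fun x y => ?_⟩
    simpa [hα, hβ] using h x y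
  exfalso
  obtain ⟨l, hl⟩ : ∃ l : ℂ, ∀ x y : S, f (x * y) = l * g (x * y) := by
    refine ⟨-β / α, fun x y => ?_⟩
    field_simp
    linear_combination h x y
  have key : ∀ a c : S,
      f (τ (τ a)) * (g c + l * f c) - f c * (g (τ a) + l * f (τ a)) = 0 ∧
      g (τ (τ a)) * (g c + l * f c) - g c * (g (τ a) + l * f (τ a)) = 0 := by
    intro a c
    refine hτindep _ _ fun b => ?_
    have h1 := hprod (a * b) c
    have h2 := hprod a (b * c)
    rw [mul_assoc, h2, hτmul, hl, hl, hprod (τ a), hprod b] at h1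
    linear_combination -h1
  have hw : ∀ a, g (τ a) + l * f (τ a) = 0 := by
    intro a
    obtain ⟨h1, h2⟩ := hindep (l * f (τ (τ a)) - (g (τ a) + l * f (τ a))) (f (τ (τ a)))
      fun c => by linear_combination (key a c).1
    linear_combination -h1 + l * h2
  exact one_ne_zero (hτindep l 1 fun x => by linear_combination hw x).2

/-- Under the variant equation, `g` is central. -/
theorem central
    (hτσ : ∀ x, τ (σ x) = x)
    (hσmul : ∀ x y : S, σ (x * y) = σ x * σ y)
    (hτmul : ∀ x y : S, τ (x * y) = τ x * τ y)
    (hprod : ∀ x y : S, g (x * y) = g (τ x) * g y + f (τ x) * f y)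
    (hindep : ∀ a b : ℂ, (∀ x : S, a * f x + b * g x = 0) → a = 0 ∧ b = 0)
    (x y : S) : g (x * y) = g (y * x) := by
  have hτindep : ∀ a b : ℂ, (∀ x : S, a * f (τ x) + b * g (τ x) = 0) → a = 0 ∧ b = 0 :=
    fun a b hab => hindep a b fun x => by simpa [hτσ] using hab (σ x)
  have hprod2 := indep_on_products hτσ hτmul hprod hindep
  obtain ⟨a, ha⟩ : ∃ a, f (τ a) ≠ 0 := by
    by_contra! hz
    exact one_ne_zero (hτindep 1 0 fun x => by simp [hz]).1
  -- The action of left translations on the span of `g` and `f`.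
  obtain ⟨φ, ψ, hf⟩ : ∃ φ ψ : S → ℂ, ∀ b c, f (b * c) = φ b * g c + ψ b * f c := by
    refine ⟨fun b => (g (τ (a * b)) - g (τ a) * g (τ b)) / f (τ a),
      fun b => (f (τ (a * b)) - g (τ a) * f (τ b)) / f (τ a), fun b c => ?_⟩
    have h1 := hprod (a * b) c
    rw [mul_assoc, hprod a (b * c), hprod b c] at h1
    field_simp
    linear_combination h1
  have hT : ∀ a b, f (τ (a * b)) = g (τ a) * f (τ b) + f (τ a) * ψ b ∧
      g (τ (a * b)) = g (τ a) * g (τ b) + f (τ a) * φ b := by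
    intro a b
    have := hindep (f (τ (a * b)) - (g (τ a) * f (τ b) + f (τ a) * ψ b))
      (g (τ (a * b)) - (g (τ a) * g (τ b) + f (τ a) * φ b)) fun c => by
        have h1 := hprod (a * b) c
        rw [mul_assoc, hprod a (b * c), hprod b c, hf] at h1
        linear_combination -h1
    exact ⟨sub_eq_zero.1 this.1, sub_eq_zero.1 this.2⟩
  obtain ⟨p, q, hφ⟩ : ∃ p q : ℂ, ∀ b, φ b = p * g (τ b) + q * f (τ b) := by
    refine ⟨(g (τ (τ a)) - g (τ a)) / f (τ a), f (τ (τ a)) / f (τ a), fun b => ?_⟩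
    have h1 := (hT a b).2
    rw [hτmul, hprod] at h1
    field_simp
    linear_combination -h1
  obtain ⟨r, s, hψ⟩ : ∃ r s : ℂ, ∀ b, ψ b = r * g (τ b) + s * f (τ b) := by
    refine ⟨φ (τ a) / f (τ a), (ψ (τ a) - g (τ a)) / f (τ a), fun b => ?_⟩
    have h1 := (hT a b).1
    rw [hτmul, hf] at h1
    field_simp
    linear_combination -h1
  have hF : ∀ a b, f (τ (a * b)) =
      g (τ a) * f (τ b) + f (τ a) * (r * g (τ b) + s * f (τ b)) := fun a b => by
    rw [(hT a b).1, hψ]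
  have hG : ∀ a b, g (τ (a * b)) =
      g (τ a) * g (τ b) + f (τ a) * (p * g (τ b) + q * f (τ b)) := fun a b => by
    rw [(hT a b).2, hφ]
  have hcomm : p = 0 ∧ r = 1 → g (x * y) = g (y * x) := by
    rintro ⟨rfl, rfl⟩
    have h1 := hG (σ x) (σ y)
    have h2 := hG (σ y) (σ x)
    rw [← hσmul] at h1 h2
    simp only [hτσ] at h1 h2
    rw [h1, h2]
    ring
  -- Structure constants of the associative product on `ℂ²` induced by `hG` and `hF`.
  have assocG : ∀ a b c, g (τ (a * b * c)) = g (τ (a * (b * c))) := fun a b c => by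
    rw [mul_assoc]
  have assocF : ∀ a b c, f (τ (a * b * c)) = f (τ (a * (b * c))) := fun a b c => by
    rw [mul_assoc]
  simp only [hG, hF] at assocG assocF
  have trilinear : ∀ k : Fin 2 → Fin 2 → ℂ,
      (∀ a b c, f (τ a) * ((k 0 0 * g (τ b) + k 0 1 * f (τ b)) * g (τ c) +
        (k 1 0 * g (τ b) + k 1 1 * f (τ b)) * f (τ c)) = 0) →
      k 0 0 = 0 ∧ k 0 1 = 0 ∧ k 1 0 = 0 ∧ k 1 1 = 0 := by
    intro k hk
    have h1 : ∀ b, k 1 0 * g (τ b) + k 1 1 * f (τ b) = 0 ∧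
        k 0 0 * g (τ b) + k 0 1 * f (τ b) = 0 := fun b =>
      hτindep _ _ fun c => by
        have := (mul_eq_zero.1 (hk a b c)).resolve_left ha
        linear_combination this
    have h2 := hτindep (k 1 1) (k 1 0) fun b => by linear_combination (h1 b).1
    have h3 := hτindep (k 0 1) (k 0 0) fun b => by linear_combination (h1 b).2
    exact ⟨h3.2, h3.1, h2.2, h2.1⟩
  obtain ⟨hrp, -, hrq, -⟩ := trilinear
    !![r * p, q + s * p - (p * p + r * q); r * q - q, -(q * p)] fun a b c => by
      simp only [Matrix.of_apply, Matrix.cons_val', Matrix.cons_val_zero, Matrix.cons_val_one,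
        Matrix.cons_val_fin_one]
      linear_combination assocG a b c
  obtain ⟨hrr, -, hprs, -⟩ := trilinear
    !![r * r - r, -(p * r); p + r * s - s, q - q * r] fun a b c => by
      simp only [Matrix.of_apply, Matrix.cons_val', Matrix.cons_val_zero, Matrix.cons_val_one,
        Matrix.cons_val_fin_one]
      linear_combination assocF a b c
  simp only [Matrix.of_apply, Matrix.cons_val', Matrix.cons_val_zero, Matrix.cons_val_one,
    Matrix.cons_val_fin_one] at hrp hrq hrr hprs
  by_cases hr : r = 0
  · subst hr
    have hq : q = 0 := by linear_combination -hrq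
    have hs : s = p := by linear_combination -hprs
    refine absurd (hprod2 1 (-p) fun b c => ?_).1 one_ne_zero
    rw [hf, hprod, hφ, hψ, hq, hs]
    ring
  · refine hcomm ⟨(mul_eq_zero.1 hrp).resolve_left hr, mul_left_cancel₀ hr ?_⟩
    linear_combination hrr

end SineAdditionVariant

theorem stmt_2 {S : Type*} [Semigroup S] (σ : S → S)
    (hσbij : Function.Bijective σ)
    (hσmul : ∀ x y : S, σ (x * y) = σ x * σ y)
    (f g : S → ℂ)
    (heq : ∀ x y : S, g (σ y * x) = g x * g y + f x * f y)
    (hindep : ∀ a b : ℂ, (∀ x : S, a * f x + b * g x = 0) → a = 0 ∧ b = 0) :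
    (∀ x : S, g (σ x) = g x) ∧
    ((∀ x : S, f (σ x) = f x) ∨ (∀ x : S, f (σ x) = -f x)) := by
  obtain ⟨τ, hτσ, hστ⟩ := Function.bijective_iff_has_inverse.1 hσbij
  have hτmul : ∀ x y : S, τ (x * y) = τ x * τ y := fun x y =>
    hσbij.1 (by rw [hσmul, hστ, hστ, hστ])
  have hprod : ∀ x y : S, g (x * y) = g (τ x) * g y + f (τ x) * f y := fun x y => by
    have := heq y (τ x)
    rw [hστ] at this
    rw [this]
    ring
  have hprod2 := SineAdditionVariant.indep_on_products hτσ hτmul hprod hindep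
  have hcentral := SineAdditionVariant.central hτσ hσmul hτmul hprod hindep
  have hsymm : ∀ x y, g (σ y * x) = g (σ x * y) := fun x y => by
    rw [heq, heq]
    ring
  have hcyclic : ∀ a b c, g (b * c * a) = g (b * c * σ (σ a)) := by
    intro a b c
    calc g (b * c * a) = g (σ (τ b) * (c * a)) := by rw [hστ, mul_assoc]
      _ = g (σ c * (σ a * τ b)) := by rw [hsymm, hσmul, mul_assoc]
      _ = g (σ (σ a) * (b * c)) := by rw [hsymm, hσmul, hστ, mul_assoc]
      _ = g (b * c * σ (σ a)) := hcentral _ _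
  have hsq : ∀ c, f (σ (σ c)) - f c = 0 ∧ g (σ (σ c)) - g c = 0 := fun c =>
    hprod2 _ _ fun a b => by
      have := hcyclic c (σ a) (σ b)
      rw [← hσmul, hprod, hprod, hτσ] at this
      linear_combination -this
  have hgg : ∀ c, g (σ (σ c)) = g c := fun c => sub_eq_zero.1 (hsq c).2
  have hff : ∀ c, f (σ (σ c)) = f c := fun c => sub_eq_zero.1 (hsq c).1
  have hgprod : ∀ x y, g (σ (x * y)) = g (x * y) := by
    intro x y
    obtain ⟨z, rfl⟩ := hσbij.2 y
    rw [hσmul, heq, hgg, hff, ← heq, hsymm, hcentral]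
  have hB : ∀ x y, g (σ x) * g (σ y) + f (σ x) * f (σ y) = g x * g y + f x * f y := by
    intro x y
    rw [← heq, ← heq, ← hσmul, hgprod]
  have hdiff : ∀ a b y, g (a * b) * (g y - g (σ y)) + f (a * b) * (f y - f (σ y)) =
      (f (a * b) - f (σ (a * b))) * f y := by
    intro a b y
    have h1 := hB (a * b) (σ y)
    rw [hgg, hff, hgprod] at h1
    linear_combination h1
  obtain ⟨y₀, hy₀⟩ : ∃ y, f y ≠ 0 := by
    by_contra! hz
    exact one_ne_zero (hindep 1 0 fun x => by simp [hz]).1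
  obtain ⟨α, β, hαβ⟩ : ∃ α β : ℂ, ∀ a b,
      f (a * b) - f (σ (a * b)) = α * g (a * b) + β * f (a * b) := by
    refine ⟨(g y₀ - g (σ y₀)) / f y₀, (f y₀ - f (σ y₀)) / f y₀, fun a b => ?_⟩
    field_simp
    linear_combination -hdiff a b y₀
  have hmul : ∀ y, f y - f (σ y) - β * f y = 0 ∧ g y - g (σ y) - α * f y = 0 := fun y =>
    hprod2 _ _ fun a b => by linear_combination hdiff a b y + f y * hαβ a b
  have hα : α = 0 := (hprod2 0 α fun a b => by
    linear_combination (hmul (a * b)).1 - hαβ a b).2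
  have hfσ : ∀ y, f (σ y) = (1 - β) * f y := fun y => by linear_combination -(hmul y).1
  refine ⟨fun x => by linear_combination -(hmul x).2 - f x * hα, ?_⟩
  have hβ : (1 - β) ^ 2 = 1 := by
    have h := hff y₀
    rw [hfσ, hfσ] at h
    exact mul_right_cancel₀ hy₀ (by linear_combination h)
  refine (sq_eq_sq_iff_eq_or_eq_neg.1 (hβ.trans (one_pow 2).symm)).imp (fun h x => ?_) fun h x => ?_ <;>
    rw [hfσ, h] <;> ring
end

section
/- Let S be a semigroup and σ : S → S an automorphism. Functions f, g : S → ℂ satisfy g(x·σ(y)) = g(x)g(y) + f(x)f(y) for all x, y ∈ S if and only if one of the following holds: (1) g = 0 and f = 0; (2) g is a nonzero function with g(xy) = 0 for all x, y ∈ S, and f = c·g for some c ∈ {i, −i}; (3) there exist a constant α ∈ ℂ \ {i, −i} and a nonzero multiplicative function χ : S → ℂ with χ ∘ σ = χ such that g = χ/(1 + α²) and f = α·χ/(1 + α²); (4) there exist a constant δ ∈ ℂ \ {0, i, −i} and two distinct multiplicative functions χ₁, χ₂ : S → ℂ with χ₁ ∘ σ = χ₁ and χ₂ ∘ σ = χ₂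 such that g = (δ⁻¹·χ₁ + δ·χ₂)/(δ⁻¹ + δ) and f = (χ₂ − χ₁)/(δ⁻¹ + δ); (5) there exists a multiplicative function χ : S → ℂ with χ ∘ σ ≠ χ and χ ∘ σ ∘ σ = χ such that g = (χ + χ∘σ)/2 and f = (χ − χ∘σ)/(2i); or (6) there exist a nonzero multiplicative function χ : S → ℂ with χ ∘ σ = χ and a function φ : S → ℂ satisfying φ(xy) = φ(x)χ(y) + φ(y)χ(x) for all x, y ∈ S and φ ∘ σ = φ, such that f = −i·φ and either g = χ + φ or g = χ − φ. -/
open Complex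

lemma one_add_sq_ne_zero_of_ne_I {a : ℂ} (h₁ : a ≠ I) (h₂ : a ≠ -I) : 1 + a ^ 2 ≠ 0 := by
  intro h
  have h' : (a - I) * (a + I) = 0 := by linear_combination h - I_sq
  rcases mul_eq_zero.mp h' with h' | h'
  · exact h₁ (sub_eq_zero.mp h')
  · exact h₂ (eq_neg_of_add_eq_zero_left h')

lemma eq_I_or_eq_neg_I_of_sq {a : ℂ} (h : a ^ 2 = -1) : a = I ∨ a = -I := by
  by_contra! hc
  exact one_add_sq_ne_zero_of_ne_I hc.1 hc.2 (by linear_combination h)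

/-- A nonzero `χ` with `χ (x * σ y) = χ x * χ y` is multiplicative and `σ`-invariant. -/
lemma multiplicative_of_twisted {S : Type*} [Semigroup S] {σ : S → S}
    (hσmul : ∀ x y : S, σ (x * y) = σ x * σ y) {χ : S → ℂ} (hχ : χ ≠ 0)
    (h : ∀ x y, χ (x * σ y) = χ x * χ y) :
    (∀ x y, χ (x * y) = χ x * χ y) ∧ ∀ x, χ (σ x) = χ x := by
  obtain ⟨x₀, hx₀⟩ := Function.ne_iff.mp hχ
  rw [Pi.zero_apply] at hx₀
  have hm : ∀ x y, χ (x * y) = χ x * χ y := by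
    intro y z
    apply mul_left_cancel₀ hx₀
    rw [← h x₀ (y * z), hσmul, ← mul_assoc, h, h, mul_assoc]
  refine ⟨hm, fun y => mul_left_cancel₀ hx₀ ?_⟩
  rw [← hm, h]

/-- For linearly independent `f` and `g`, the cosine subtraction law reduces to an addition law
on `S` together with `g ∘ σ = g` and `f ∘ σ = ± f`. -/
lemma addition_laws_of_linearIndependent {S : Type*} [Semigroup S] {σ : S → S}
    (hσbij : Function.Bijective σ) (hσmul : ∀ x y : S, σ (x * y) = σ x * σ y) {f g : S → ℂ}
    (h : ∀ x y : S, g (x * σ y) = g x * g y + f x * f y)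
    (hind : ∀ a b : ℂ, (∀ x, a * g x + b * f x = 0) → a = 0 ∧ b = 0) :
    ∃ ε b : ℂ, (ε = 1 ∨ ε = -1 ∧ b = 0) ∧
      (∀ x, g (σ x) = g x) ∧ (∀ x, f (σ x) = ε * f x) ∧
      (∀ x y, g (x * y) = g x * g y + ε * (f x * f y)) ∧
      (∀ x y, f (x * y) = f x * g y + g x * f y + b * (f x * f y)) := by
  obtain ⟨z₀, hz₀⟩ : ∃ z, f z ≠ 0 := by
    by_contra! hc
    simpa using (hind 0 1 (by simp [hc])).2
  obtain ⟨y₀, rfl⟩ := hσbij.surjective z₀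
  have key : ∀ x y z, f (x * σ y) * f z =
      g x * (g (y * z) - g y * g z) + f x * (f (y * z) - f y * g z) := by
    intro x y z
    have h₁ := h x (y * z)
    rw [hσmul, ← mul_assoc, h, h] at h₁
    linear_combination h₁
  obtain ⟨A, B, hAB⟩ : ∃ A B : S → ℂ, ∀ x y, f (x * σ y) = g x * A y + f x * B y := by
    refine ⟨fun y => (g (y * σ y₀) - g y * g (σ y₀)) / f (σ y₀),
      fun y => (f (y * σ y₀) - f y * g (σ y₀)) / f (σ y₀), fun x y => ?_⟩
    have := key x y (σ y₀)
    field_simp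
    linear_combination this
  have hyz : ∀ y z, A y * f z - g (y * z) + g y * g z = 0 ∧
      B y * f z - f (y * z) + f y * g z = 0 := fun y z => hind _ _ fun x => by
    have := key x y z
    rw [hAB] at this
    linear_combination this
  have hg : ∀ y z, g (y * z) = g y * g z + A y * f z := fun y z => by
    linear_combination -(hyz y z).1
  have hf : ∀ y z, f (y * z) = f y * g z + B y * f z := fun y z => by
    linear_combination -(hyz y z).2
  have eg : ∀ x y, g x * g y + f x * f y = g x * g (σ y) + A x * f (σ y) := fun x y => by
    rw [← h, hg]
  have ef : ∀ x y, g x * A y + f x * B y = f x * g (σ y) + B x * f (σ y) := fun x y => by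
    rw [← hAB, hf]
  obtain ⟨a₁, a₂, hA⟩ : ∃ a₁ a₂ : ℂ, ∀ x, A x = a₁ * g x + a₂ * f x := by
    refine ⟨(g y₀ - g (σ y₀)) / f (σ y₀), f y₀ / f (σ y₀), fun x => ?_⟩
    have := eg x y₀
    field_simp
    linear_combination -this
  obtain ⟨b₁, b₂, hB⟩ : ∃ b₁ b₂ : ℂ, ∀ x, B x = b₁ * g x + b₂ * f x := by
    refine ⟨A y₀ / f (σ y₀), (B y₀ - g (σ y₀)) / f (σ y₀), fun x => ?_⟩
    have := ef x y₀
    field_simp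
    linear_combination -this
  have cg : ∀ y, g y - g (σ y) - a₁ * f (σ y) = 0 ∧ f y - a₂ * f (σ y) = 0 := fun y =>
    hind _ _ fun x => by
      have := eg x y
      rw [hA] at this
      linear_combination this
  have cf : ∀ y, A y - b₁ * f (σ y) = 0 ∧ B y - g (σ y) - b₂ * f (σ y) = 0 := fun y =>
    hind _ _ fun x => by
      have := ef x y
      rw [hB x] at this
      linear_combination this
  have hA' : a₂ * a₁ = 0 ∧ a₂ * a₂ - b₁ = 0 := hind _ _ fun y => by
    linear_combination a₂ * (cf y).1 - b₁ * (cg y).2 - a₂ * hA y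
  have ha₂ : a₂ ≠ 0 := by
    rintro rfl
    have := hind 0 1 fun y => by linear_combination (cg y).2
    simpa using this.2
  have ha₁ : a₁ = 0 := (mul_eq_zero.mp hA'.1).resolve_left ha₂
  have hB' : a₂ * (b₁ - 1) = 0 ∧ a₂ * b₂ - b₂ = 0 := hind _ _ fun y => by
    have h₁ := (cg y).1
    rw [ha₁] at h₁
    linear_combination a₂ * (cf y).2 - a₂ * hB y - a₂ * h₁ - b₂ * (cg y).2
  have hb₁ : b₁ = 1 := by
    linear_combination (mul_eq_zero.mp hB'.1).resolve_left ha₂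
  have hsq : a₂ * a₂ = 1 := by linear_combination hA'.2 + hb₁
  refine ⟨a₂, b₂, ?_, fun x => ?_, fun x => ?_, fun x y => ?_, fun x y => ?_⟩
  · rcases mul_self_eq_one_iff.mp hsq with h₁ | h₁
    · exact Or.inl h₁
    · refine Or.inr ⟨h₁, ?_⟩
      have := hB'.2
      rw [h₁] at this
      linear_combination -this / 2
  · have := (cg x).1
    rw [ha₁] at this
    linear_combination -this
  · linear_combination -a₂ * (cg x).2 - f (σ x) * hsq
  · rw [hg, hA, ha₁]
    ring
  · rw [hf, hB, hb₁]
    ring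

theorem stmt_3 {S : Type*} [Semigroup S] (σ : S → S)
    (hσbij : Function.Bijective σ)
    (hσmul : ∀ x y : S, σ (x * y) = σ x * σ y)
    (f g : S → ℂ) :
    (∀ x y : S, g (x * σ y) = g x * g y + f x * f y) ↔
    ((g = 0 ∧ f = 0) ∨
     (g ≠ 0 ∧ (∀ x y : S, g (x * y) = 0) ∧
       ∃ c : ℂ, (c = I ∨ c = -I) ∧ f = fun x => c * g x) ∨
     (∃ (α : ℂ) (χ : S → ℂ), α ≠ I ∧ α ≠ -I ∧ χ ≠ 0 ∧
       (∀ x y : S, χ (x * y) = χ x * χ y) ∧ (∀ x : S, χ (σ x) = χ x) ∧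
       g = (fun x => χ x / (1 + α ^ 2)) ∧ f = (fun x => α * χ x / (1 + α ^ 2))) ∨
     (∃ (δ : ℂ) (χ₁ χ₂ : S → ℂ), δ ≠ 0 ∧ δ ≠ I ∧ δ ≠ -I ∧ χ₁ ≠ χ₂ ∧
       (∀ x y : S, χ₁ (x * y) = χ₁ x * χ₁ y) ∧
       (∀ x y : S, χ₂ (x * y) = χ₂ x * χ₂ y) ∧
       (∀ x : S, χ₁ (σ x) = χ₁ x) ∧ (∀ x : S, χ₂ (σ x) = χ₂ x) ∧
       g = (fun x => (δ⁻¹ * χ₁ x + δ * χ₂ x) / (δ⁻¹ + δ)) ∧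
       f = (fun x => (χ₂ x - χ₁ x) / (δ⁻¹ + δ))) ∨
     (∃ χ : S → ℂ, (∀ x y : S, χ (x * y) = χ x * χ y) ∧
       (fun x => χ (σ x)) ≠ χ ∧ (∀ x : S, χ (σ (σ x)) = χ x) ∧
       g = (fun x => (χ x + χ (σ x)) / 2) ∧
       f = (fun x => (χ x - χ (σ x)) / (2 * I))) ∨
     (∃ (χ φ : S → ℂ), χ ≠ 0 ∧
       (∀ x y : S, χ (x * y) = χ x * χ y) ∧ (∀ x : S, χ (σ x) = χ x) ∧
       (∀ x y : S, φ (x * y) = φ x * χ y + φ y * χ x) ∧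
       (∀ x : S, φ (σ x) = φ x) ∧
       f = (fun x => -I * φ x) ∧
       (g = (fun x => χ x + φ x) ∨ g = (fun x => χ x - φ x)))) := by
  constructor
  · intro h
    by_cases hg0 : g = 0
    · refine Or.inl ⟨hg0, funext fun x => ?_⟩
      have := h x x
      simpa [hg0] using this
    by_cases hdep : ∃ c : ℂ, ∀ x, f x = c * g x
    · obtain ⟨c, hc⟩ := hdep
      by_cases hc2 : c = I ∨ c = -I
      · refine Or.inr (Or.inl ⟨hg0, fun x y => ?_, c, hc2, funext hc⟩)
        obtain ⟨y, rfl⟩ := hσbij.surjective y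
        have hcc : c ^ 2 = -1 := by rcases hc2 with rfl | rfl <;> simp
        rw [h, hc, hc]
        linear_combination g x * g y * hcc
      · push Not at hc2
        have hne := one_add_sq_ne_zero_of_ne_I hc2.1 hc2.2
        have hχ : (fun x => (1 + c ^ 2) * g x) ≠ 0 := fun h0 => hg0 <| funext fun x => by
          simpa [hne] using congrFun h0 x
        obtain ⟨hm, hinv⟩ := multiplicative_of_twisted hσmul hχ fun x y => by
          rw [h, hc, hc]
          ring
        refine Or.inr (Or.inr (Or.inl ⟨c, _, hc2.1, hc2.2, hχ, hm, hinv, ?_, ?_⟩)) <;>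
          funext x
        · field_simp
        · rw [hc]
          field_simp
    · have hind : ∀ a b : ℂ, (∀ x, a * g x + b * f x = 0) → a = 0 ∧ b = 0 := by
        intro a b hab
        have hb : b = 0 := by
          by_contra hb
          refine hdep ⟨-a / b, fun x => ?_⟩
          field_simp
          linear_combination hab x
        refine ⟨?_, hb⟩
        by_contra ha
        exact hg0 <| funext fun x => by simpa [hb, ha] using hab x
      have hf0 : ∃ x, f x ≠ 0 := by
        by_contra! hc
        exact hdep ⟨0, by simp [hc]⟩
      obtain ⟨x₀, hx₀⟩ := hf0
      obtain ⟨ε, b, hε, hgσ, hfσ, hg, hf⟩ :=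
        addition_laws_of_linearIndependent hσbij hσmul h hind
      right; right; right
      rcases hε with rfl | ⟨rfl, rfl⟩
      · simp only [one_mul] at hfσ hg
        obtain ⟨l, hl⟩ : ∃ l : ℂ, l ^ 2 = 1 + l * b := by
          obtain ⟨s, hs⟩ := IsAlgClosed.exists_pow_nat_eq (b ^ 2 + 4) (n := 2) (by norm_num)
          exact ⟨(b + s) / 2, by linear_combination hs / 4⟩
        have hl0 : l ≠ 0 := by
          rintro rfl
          simp at hl
        have hm : ∀ x y, g (x * y) + l * f (x * y) = (g x + l * f x) * (g y + l * f y) := by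
          intro x y
          rw [hg, hf]
          linear_combination -f x * f y * hl
        by_cases hl2 : l = I ∨ l = -I
        · right; right
          have hsq : l ^ 2 = -1 := by rcases hl2 with rfl | rfl <;> simp
          have hb : b = 2 * l := mul_left_cancel₀ hl0 (by linear_combination -hl - hsq)
          refine ⟨fun x => g x + l * f x, fun x => I * f x, fun h0 => ?_, hm,
            fun x => by simp [hgσ, hfσ], fun x y => ?_, fun x => by simp [hfσ], ?_, ?_⟩
          · have := hind 1 l fun x => by simpa using congrFun h0 x
            exact one_ne_zero this.1
          · simp only [hf, hb]
            ring
          · funext x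
            linear_combination f x * I_sq
          · rcases hl2 with rfl | rfl
            · right
              funext x
              ring
            · left
              funext x
              ring
        · left
          push Not at hl2
          have hne := one_add_sq_ne_zero_of_ne_I hl2.1 hl2.2
          have hm' : ∀ x y, g (x * y) + -l⁻¹ * f (x * y) =
              (g x + -l⁻¹ * f x) * (g y + -l⁻¹ * f y) := by
            intro x y
            rw [hg, hf]
            field_simp
            linear_combination f x * f y * hl
          have hinv : l⁻¹ ^ 2 ≠ -1 := fun hc => hne <| by
            field_simp at hc
            linear_combination hc
          refine ⟨l⁻¹, fun x => g x + -l⁻¹ * f x, fun x => g x + l * f x,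
            inv_ne_zero hl0, ?_, ?_, ?_, hm', hm, ?_, ?_, ?_, ?_⟩
          · intro hc
            simp [hc] at hinv
          · intro hc
            simp [hc] at hinv
          · intro hc
            have h₁ := congrFun hc x₀
            field_simp at h₁
            have h₂ : f x₀ * (1 + l ^ 2) = 0 := by linear_combination -h₁
            exact mul_ne_zero hx₀ hne h₂
          · simp [hgσ, hfσ]
          · simp [hgσ, hfσ]
          · funext x
            have : l ^ 2 + 1 ≠ 0 := by rwa [add_comm]
            rw [inv_inv]
            field_simp
            ring
          · funext x
            have : l ^ 2 + 1 ≠ 0 := by rwa [add_comm]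
            rw [inv_inv]
            field_simp
            ring
      · right; left
        refine ⟨fun x => g x + I * f x, fun x y => ?_, fun hc => ?_, fun x => ?_, ?_, ?_⟩
        · simp only [hg, hf]
          linear_combination -f x * f y * I_sq
        · have h₁ := congrFun hc x₀
          simp only [hgσ, hfσ] at h₁
          have h₂ : 2 * I * f x₀ = 0 := by linear_combination -h₁
          simp [hx₀] at h₂
        · simp [hgσ, hfσ]
        · funext x
          simp only [hgσ, hfσ]
          ring
        · funext x
          simp only [hgσ, hfσ]
          field_simp
          ring
  · rintro (⟨rfl, rfl⟩ | ⟨-, hg, c, hc, rfl⟩ | ⟨α, χ, h₁, h₂, -, hm, hσ, rfl, rfl⟩ |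
      ⟨δ, χ₁, χ₂, h₀, h₁, h₂, -, hm₁, hm₂, hσ₁, hσ₂, rfl, rfl⟩ |
      ⟨χ, hm, -, hσ, rfl, rfl⟩ | ⟨χ, φ, -, hm, hσ, hφ, hφσ, rfl, rfl | rfl⟩) x y
    · simp
    · have hcc : c ^ 2 = -1 := by rcases hc with rfl | rfl <;> simp
      rw [hg]
      linear_combination -g x * g y * hcc
    · have := one_add_sq_ne_zero_of_ne_I h₁ h₂
      simp only [hm, hσ]
      field_simp
    · have := one_add_sq_ne_zero_of_ne_I h₁ h₂
      simp only [hm₁, hm₂, hσ₁, hσ₂]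
      field_simp
      ring
    · simp only [hm, hσmul, hσ]
      field_simp
      linear_combination -(χ x - χ (σ x)) * (χ y - χ (σ y)) * I_sq
    · simp only [hm, hσ, hφ, hφσ]
      linear_combination -φ x * φ y * I_sq
    · simp only [hm, hσ, hφ, hφσ]
      linear_combination -φ x * φ y * I_sq
end

section
/- Let S be a semigroup and σ : S → S an automorphism. If f, g : S → ℂ satisfy g(x·σ(y)) = g(x)g(y) + f(x)f(y) for all x, y ∈ S, then both f and g are abelian; that is, f(xy) = f(yx), g(xy) = g(yx), f(xyz) = f(xzy) and g(xyz) = g(xzy) for all x, y, z ∈ S. -/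
open Complex

/-- A function with `h (x * σ y) = k * h x * h y` satisfies `h (x * y) = k * h x * h y`. -/
lemma mul_eq_of_twisted_mul_eq {S : Type*} [Semigroup S] {σ : S → S}
    (hσsurj : Function.Surjective σ) (hσmul : ∀ x y : S, σ (x * y) = σ x * σ y)
    {h : S → ℂ} {k : ℂ} (hh : ∀ x y : S, h (x * σ y) = k * h x * h y) (x y : S) :
    h (x * y) = k * h x * h y := by
  by_cases h0 : ∀ t, h t = 0
  · simp [h0]
  push Not at h0
  obtain ⟨t, ht⟩ := h0
  by_cases hk : k = 0
  · obtain ⟨z, rfl⟩ := hσsurj y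
    rw [hh, hk]
    ring
  have e := hh t (x * y)
  rw [hσmul, ← mul_assoc, hh, hh] at e
  have : k * h t ≠ 0 := mul_ne_zero hk ht
  apply mul_left_cancel₀ this
  linear_combination -e

/-- If the transpose of each of two `2 × 2` matrices `[g, f; a, g - d]` commutes with both
matrices, then the two matrices commute with each other; this is what it says about entries. -/
lemma commute_of_commute_transpose {f₁ f₂ a₁ a₂ d₁ d₂ : ℂ}
    (h₁ : f₁ * f₁ = a₁ * a₁) (h₂ : f₂ * f₂ = a₂ * a₂) (h₁₂ : f₁ * f₂ = a₁ * a₂)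
    (k₁ : a₁ * d₁ = f₁ * d₁) (k₁₂ : a₁ * d₂ = f₂ * d₁) (k₂₁ : a₂ * d₁ = f₁ * d₂) :
    a₁ * f₂ = a₂ * f₁ ∧ f₁ * d₂ = f₂ * d₁ := by
  rcases mul_self_eq_mul_self_iff.1 h₁ with h | h
  · subst h
    by_cases ha : f₁ = 0
    · subst ha
      rcases mul_self_eq_mul_self_iff.1 h₂ with h' | h' <;> grind
    · have := mul_left_cancel₀ ha h₁₂
      grind
  · by_cases ha : a₁ = 0
    · subst ha
      rcases mul_self_eq_mul_self_iff.1 h₂ with h' | h' <;> grind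
    · have h3 : f₂ = -a₂ := mul_left_cancel₀ ha (by grind)
      have h4 : d₁ = 0 := by grind
      grind

theorem stmt_4 {S : Type*} [Semigroup S] (σ : S → S)
    (hσbij : Function.Bijective σ)
    (hσmul : ∀ x y : S, σ (x * y) = σ x * σ y)
    (f g : S → ℂ)
    (heq : ∀ x y : S, g (x * σ y) = g x * g y + f x * f y) :
    (∀ x y : S, f (x * y) = f (y * x)) ∧
    (∀ x y : S, g (x * y) = g (y * x)) ∧
    (∀ x y z : S, f (x * y * z) = f (x * z * y)) ∧
    (∀ x y z : S, g (x * y * z) = g (x * z * y)) := by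
  by_cases hf : ∀ t, f t = 0
  · have hg := mul_eq_of_twisted_mul_eq (h := g) (k := 1) hσbij.2 hσmul
      (by intro x y; rw [heq, hf]; ring)
    refine ⟨by simp [hf], ?_, by simp [hf], ?_⟩ <;> intros <;> simp only [hg] <;> ring
  push Not at hf
  obtain ⟨t, ht⟩ := hf
  by_cases hdep : ∃ c, ∀ x, g x = c * f x
  · obtain ⟨c, hc⟩ := hdep
    have hc0 : c ≠ 0 := by
      rintro rfl
      have := heq t t
      simp [hc, ht] at this
    have hm := mul_eq_of_twisted_mul_eq (h := f) (k := (c * c + 1) / c) hσbij.2 hσmul (by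
      intro x y
      have := heq x y
      simp only [hc] at this
      field_simp
      linear_combination this)
    refine ⟨?_, ?_, ?_, ?_⟩ <;> intros <;> simp only [hc, hm] <;> ring
  have hind : ∀ a b a' b' : ℂ, (∀ x, g x * a + f x * b = g x * a' + f x * b') →
      a = a' ∧ b = b' := by
    intro a b a' b' h
    have ha : a = a' := by
      by_contra hne
      refine hdep ⟨(b' - b) / (a - a'), fun x => ?_⟩
      have := sub_ne_zero.2 hne
      field_simp
      linear_combination h x
    subst ha
    exact ⟨rfl, mul_left_cancel₀ ht (by linear_combination h t)⟩
  have key : ∀ x y z, f (x * σ y) * f z =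
      g x * (g (y * z) - g y * g z) + f x * (f (y * z) - f y * g z) := by
    intro x y z
    have e := heq x (y * z)
    rw [hσmul, ← mul_assoc, heq, heq] at e
    linear_combination e
  obtain ⟨A, B, hfσ⟩ : ∃ A B : S → ℂ, ∀ x y, f (x * σ y) = g x * A y + f x * B y := by
    refine ⟨fun y => (g (y * t) - g y * g t) / f t, fun y => (f (y * t) - f y * g t) / f t,
      fun x y => ?_⟩
    field_simp
    linear_combination key x y t
  have hmul : ∀ y z, g (y * z) = g y * g z + A y * f z ∧ f (y * z) = f y * g z + B y * f z := by
    intro y z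
    have := hind (A y * f z) (B y * f z) (g (y * z) - g y * g z) (f (y * z) - f y * g z)
      (fun x => by rw [← key, hfσ]; ring)
    exact ⟨by linear_combination -this.1, by linear_combination -this.2⟩
  have hAB : ∀ y z, A (y * z) = g y * A z + A y * B z ∧ B (y * z) = f y * A z + B y * B z := by
    intro y z
    apply hind
    intro x
    rw [← hfσ, hσmul, ← mul_assoc, hfσ, heq, hfσ]
    ring
  have hcomm : ∀ y z, f z * f y = A z * A y ∧
      A z * g y + B z * f y = g z * f y + A z * B y := by
    intro y z
    have := hind (g z * g y + f z * f y) (A z * g y + B z * f y)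
      (g z * g y + A z * A y) (g z * f y + A z * B y) (fun x => by
        have e₁ := heq (z * x) y
        have e₂ := heq x y
        have e₃ := hfσ x y
        rw [(hmul _ _).1] at e₁ e₂
        rw [(hmul _ _).2] at e₃
        rw [(hmul z x).1, (hmul z x).2, (hAB z x).1] at e₁
        linear_combination -e₁ + g z * e₂ + A z * e₃)
    exact ⟨by linear_combination this.1, this.2⟩
  have hc : ∀ x y, A x * f y = A y * f x ∧ f x * (g y - B y) = f y * (g x - B x) :=
    fun x y => commute_of_commute_transpose (hcomm x x).1 (hcomm y y).1 (hcomm y x).1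
      (by linear_combination (hcomm x x).2) (by linear_combination (hcomm y x).2)
      (by linear_combination (hcomm x y).2)
  have hgc : ∀ x y, g (x * y) = g (y * x) := fun x y => by
    rw [(hmul x y).1, (hmul y x).1]
    linear_combination (hc x y).1
  have hfc : ∀ x y, f (x * y) = f (y * x) := fun x y => by
    rw [(hmul x y).2, (hmul y x).2]
    linear_combination (hc x y).2
  refine ⟨hfc, hgc, fun x y z => ?_, fun x y z => ?_⟩
  · rw [mul_assoc, mul_assoc, (hmul x _).2, (hmul x _).2, hfc y z, hgc y z]
  · rw [mul_assoc, mul_assoc, (hmul x _).1, (hmul x _).1, hfc y z, hgc y z]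
end

section
/- Let S be a semigroup and σ : S → S an automorphism. Functions f, g : S → ℂ satisfy g(x·σ(y)) = g(x)g(y) + f(x)f(y) for all x, y ∈ S if and only if they satisfy the variant equation g(σ(y)·x) = g(x)g(y) + f(x)f(y) for all x, y ∈ S. -/
open Complex

/-- If `f` is not a scalar multiple of `g`, and `f = 0` whenever `g = 0`, then `f` and `g` are
linearly independent. -/
theorem linear_independent_of_not_proportional {S : Type*} {f g : S → ℂ}
    (hg : (∀ x, g x = 0) → ∀ x, f x = 0) (hfg : ¬ ∃ c, ∀ x, f x = c * g x)
    {a b : ℂ} (h : ∀ x, a * g x + b * f x = 0) : a = 0 ∧ b = 0 := by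
  have hb : b = 0 := by
    by_contra hb
    refine hfg ⟨-a / b, fun x => ?_⟩
    field_simp
    linear_combination h x
  refine ⟨?_, hb⟩
  by_contra ha
  refine hfg ⟨0, fun x => ?_⟩
  rw [zero_mul]
  refine hg (fun y => ?_) x
  simpa [hb, ha] using h y

/-- The component `g` of a solution of the cosine-sine equation with an automorphism is central. -/
theorem central_of_cosine_sine {S : Type*} [Semigroup S] (σ : S → S)
    (hσsurj : Function.Surjective σ) (hσmul : ∀ x y : S, σ (x * y) = σ x * σ y)
    (f g : S → ℂ) (h : ∀ x y : S, g (x * σ y) = g x * g y + f x * f y) (x y : S) :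
    g (x * y) = g (y * x) := by
  have assoc : ∀ x y z, g x * (g y * g z + f y * f z) + f x * f (y * σ z) =
      (g x * g y + f x * f y) * g (σ z) + f (x * σ y) * f (σ z) := fun x y z => by
    rw [← h y z, ← h, ← h x y, ← h, hσmul, mul_assoc]
  suffices H : ∃ a b : ℂ, ∀ x y, g (x * y) = a * (g x * g y) + b * (f x * f y) by
    obtain ⟨a, b, H⟩ := H
    rw [H, H]; ring
  by_cases hfg : ∃ c, ∀ x, f x = c * g x
  · obtain ⟨c, hc⟩ := hfg
    have hmul : ∀ x y, g (x * σ y) = (1 + c ^ 2) * (g x * g y) := fun x y => by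
      rw [h, hc, hc]; ring
    by_cases hk : 1 + c ^ 2 = 0
    · refine ⟨0, 0, fun x y => ?_⟩
      obtain ⟨y, rfl⟩ := hσsurj y
      rw [hmul, hk]; ring
    by_cases hg : ∀ x, g x = 0
    · exact ⟨0, 0, fun x y => by simp [hg]⟩
    push Not at hg
    obtain ⟨t, ht⟩ := hg
    have hgσ : ∀ z, g (σ z) = g z := fun z => by
      have h1 : g (t * σ (t * σ z)) = g (t * σ t * σ (σ z)) := by rw [hσmul, mul_assoc]
      simp only [hmul] at h1
      have h2 : (1 + c ^ 2) ^ 2 * g t ^ 2 * (g (σ z) - g z) = 0 := by linear_combination -h1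
      simpa [hk, ht, sub_eq_zero] using h2
    refine ⟨1 + c ^ 2, 0, fun x y => ?_⟩
    obtain ⟨y, rfl⟩ := hσsurj y
    rw [hmul, hgσ]; ring
  have hg0 : (∀ x, g x = 0) → ∀ x, f x = 0 := fun h0 x => by
    simpa [h0] using h x x
  have indep : ∀ a b : ℂ, (∀ x, a * g x + b * f x = 0) → a = 0 ∧ b = 0 := fun a b hab =>
    linear_independent_of_not_proportional hg0 hfg hab
  have hf : ∃ t, f (σ t) ≠ 0 := by
    by_contra! hf
    refine hfg ⟨0, fun x => ?_⟩
    obtain ⟨y, rfl⟩ := hσsurj x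
    simp [hf]
  obtain ⟨t, ht⟩ := hf
  obtain ⟨α, β, B, hfmul⟩ : ∃ (α β : ℂ) (B : S → ℂ),
      ∀ x y, f (x * σ y) = g x * (α * g y + β * f y) + f x * B y := by
    refine ⟨(g t - g (σ t)) / f (σ t), f t / f (σ t),
      fun y => (f (y * σ t) - f y * g (σ t)) / f (σ t), fun x y => ?_⟩
    field_simp
    linear_combination -assoc x y t
  have coeff : ∀ y z, g y * g z + f y * f z - g y * g (σ z) - (α * g y + β * f y) * f (σ z) = 0 ∧
      f (y * σ z) - f y * g (σ z) - B y * f (σ z) = 0 := fun y z =>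
    indep _ _ fun x => by
      linear_combination assoc x y z + f (σ z) * hfmul x y
  have hσ : ∀ z, g z - g (σ z) - α * f (σ z) = 0 ∧ f z - β * f (σ z) = 0 := fun z =>
    indep _ _ fun y => by linear_combination (coeff y z).1
  have hgσ : ∀ z, g (σ z) = g z - α * f (σ z) := fun z => by linear_combination -(hσ z).1
  have hfσ : ∀ z, f z = β * f (σ z) := fun z => by linear_combination (hσ z).2
  have hβ : β ≠ 0 := by
    rintro rfl
    exact hfg ⟨0, fun x => by simpa using hfσ x⟩
  obtain ⟨l, m, hB⟩ : ∃ l m : ℂ, ∀ y, B y = l * g y + m * f y := by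
    refine ⟨(α * g t + β * f t) / f (σ t), (B t - g (σ t)) / f (σ t), fun y => ?_⟩
    field_simp
    linear_combination hfmul y t - (coeff y t).2
  have coeff' : ∀ z, α * g z + β * f z - l * f (σ z) = 0 ∧
      B z - g (σ z) - m * f (σ z) = 0 := fun z =>
    indep _ _ fun y => by
      linear_combination (coeff y z).2 - hfmul y z + f (σ z) * hB y
  have hα := indep (β * α) (β ^ 2 - l) fun z => by
    linear_combination β * (coeff' z).1 - l * hfσ z
  have hα0 : α = 0 := by simpa [hβ] using hα.1
  have hl : l = β ^ 2 := by linear_combination -hα.2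
  have hβ2 := indep (β * (l - 1)) (β * m - m) fun z => by
    linear_combination β * (coeff' z).2 - β * hB z + β * hgσ z - m * hfσ z -
      β * f (σ z) * hα0
  have hβ1 : β ^ 2 = 1 := by
    have : l - 1 = 0 := by simpa [hβ] using hβ2.1
    linear_combination this - hl
  refine ⟨1, β, fun x y => ?_⟩
  obtain ⟨y, rfl⟩ := hσsurj y
  rw [h, hgσ, hfσ y, hα0]
  ring

theorem stmt_5 {S : Type*} [Semigroup S] (σ : S → S)
    (hσbij : Function.Bijective σ)
    (hσmul : ∀ x y : S, σ (x * y) = σ x * σ y)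
    (f g : S → ℂ) :
    (∀ x y : S, g (x * σ y) = g x * g y + f x * f y) ↔
    (∀ x y : S, g (σ y * x) = g x * g y + f x * f y) := by
  constructor
  · intro h x y
    rw [central_of_cosine_sine σ hσbij.surjective hσmul f g h, h]
  · intro h x y
    have hop := central_of_cosine_sine (S := Sᵐᵒᵖ) (fun x => .op (σ x.unop))
      (MulOpposite.op_surjective.comp (hσbij.surjective.comp MulOpposite.unop_surjective))
      (fun x y => by simp [hσmul]) (fun x => f x.unop) (fun x => g x.unop)
      (fun x y => by simpa using h x.unop y.unop) (.op (σ y)) (.op x)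
    rw [← h]
    simpa using hop
end

section
/- Let S be a semigroup and σ : S → S an automorphism. Suppose f, g : S → ℂ satisfy f(x·σ(y)) = f(x)g(y) + f(y)g(x) for all x, y ∈ S, and suppose f and g are linearly independent. Then f ∘ σ = f and g ∘ σ = g. -/
open Complex

theorem stmt_6 {S : Type*} [Semigroup S] (σ : S → S)
    (hσbij : Function.Bijective σ)
    (hσmul : ∀ x y : S, σ (x * y) = σ x * σ y)
    (f g : S → ℂ)
    (heq : ∀ x y : S, f (x * σ y) = f x * g y + f y * g x)
    (hindep : ∀ a b : ℂ, (∀ x : S, a * f x + b * g x = 0) → a = 0 ∧ b = 0) :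
    (∀ x : S, f (σ x) = f x) ∧ (∀ x : S, g (σ x) = g x) := by
  obtain ⟨w, hw⟩ : ∃ w, f w ≠ 0 := by
    by_contra! h
    simpa using (hindep 1 0 (by simp [h])).1
  have assoc : ∀ x y z, f z * g (x * σ y) =
      f x * (g (y * z) - g y * g z) + g x * (f (y * z) - f y * g z) := by
    intro x y z
    have h1 := heq (x * σ y) z
    rw [mul_assoc, ← hσmul, heq, heq] at h1
    linear_combination -h1
  -- Addition laws for `f` and `g`, with coefficients depending on one variable.
  obtain ⟨φ, ψ, hgσ⟩ : ∃ φ ψ : S → ℂ, ∀ x y, g (x * σ y) = f x * φ y + g x * ψ y := by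
    refine ⟨fun y => (g (y * w) - g y * g w) / f w, fun y => (f (y * w) - f y * g w) / f w,
      fun x y => ?_⟩
    have h := assoc x y w
    field_simp
    linear_combination h
  have add_laws : ∀ y z, g (y * z) - g y * g z - f z * φ y = 0 ∧
      f (y * z) - f y * g z - f z * ψ y = 0 := by
    refine fun y z => hindep _ _ fun x => ?_
    linear_combination f z * hgσ x y - assoc x y z
  have gadd : ∀ y z, g (y * z) = g y * g z + f z * φ y := fun y z => by
    linear_combination (add_laws y z).1
  have fadd : ∀ y z, f (y * z) = f y * g z + f z * ψ y := fun y z => by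
    linear_combination (add_laws y z).2
  have twist : ∀ y z, f y * g (σ z) + f (σ z) * ψ y = f y * g z + f z * g y := fun y z => by
    rw [← fadd, heq]
  obtain ⟨v, hv⟩ := hσbij.surjective w
  obtain ⟨p, q, hψ⟩ : ∃ p q : ℂ, ∀ y, ψ y = p * f y + q * g y := by
    refine ⟨(g v - g w) / f w, f v / f w, fun y => ?_⟩
    have h := twist y v
    rw [hv] at h
    field_simp
    linear_combination h
  have coeffs : ∀ z, g (σ z) - g z + p * f (σ z) = 0 ∧ q * f (σ z) - f z = 0 := by
    refine fun z => hindep _ _ fun y => ?_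
    have h := twist y z
    rw [hψ] at h
    linear_combination h
  have hf : ∀ z, f z = q * f (σ z) := fun z => by linear_combination -(coeffs z).2
  have hg : ∀ z, g (σ z) = g z - p * f (σ z) := fun z => by linear_combination (coeffs z).1
  have hq : q ≠ 0 := by
    rintro rfl
    exact hw (by simpa using hf w)
  have hp : p = 0 := by
    have h1 := hf (w * w)
    rw [hσmul, fadd, fadd, hψ, hψ, hg] at h1
    have h2 : p * (f w * f w) = 0 := by
      linear_combination h1 / 2 - ((1 + q) * g w / 2 - p * f w / 2 - p * q * f (σ w) / 2) * hf w
    simpa [hw] using h2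
  subst hp
  have hg' : ∀ z, g (σ z) = g z := fun z => by simpa using hg z
  have key : ∀ x y, q * (g x * g y) + f y * φ x = q * (f x * φ y) + q ^ 2 * (g x * g y) := by
    intro x y
    have h := hgσ x y
    rw [gadd, hg', hψ] at h
    linear_combination q * h + φ x * hf y
  obtain ⟨a, b, hφ⟩ : ∃ a b : ℂ, ∀ x, φ x = a * f x + b * g x := by
    refine ⟨q * φ w / f w, (q ^ 2 - q) * g w / f w, fun x => ?_⟩
    have h := key x w
    field_simp
    linear_combination h
  have hcoeff : ∀ y, b * f y + (q - q ^ 2) * g y = 0 := by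
    intro y
    refine (hindep (a * f y - q * φ y) _ fun x => ?_).2
    have h := key x y
    rw [hφ x] at h
    linear_combination h
  have hq1 : q = 1 := by
    have h := (hindep _ _ hcoeff).2
    have h' : q * (1 - q) = 0 := by linear_combination h
    rcases mul_eq_zero.mp h' with h0 | h0
    · exact absurd h0 hq
    · linear_combination -h0
  subst hq1
  exact ⟨fun x => by simpa using (hf x).symm, hg'⟩
end

section
/- Let S be a semigroup and σ : S → S an automorphism. If f, g : S → ℂ satisfy f(x·σ(y)) = f(x)g(y) + f(y)g(x) for all x, y ∈ S and f ≠ 0, then both f and g are abelian; that is, f(xy) = f(yx), g(xy) = g(yx), f(xyz) = f(xzy) and g(xyz) = g(xzy) for all x, y, z ∈ S. -/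
open Complex

/-- If `g` is not a multiple of `f ≠ 0`, then `f` and `g` are linearly independent. -/
theorem coeff_eq_zero_of_not_multiple {S : Type*} {f g : S → ℂ} {z : S} (hz : f z ≠ 0)
    (h : ¬ ∃ l : ℂ, ∀ x, g x = l * f x) {a b : ℂ} (hab : ∀ x, a * f x + b * g x = 0) :
    a = 0 ∧ b = 0 := by
  have hb : b = 0 := by
    by_contra hb
    refine h ⟨-a / b, fun x => ?_⟩
    field_simp
    linear_combination hab x
  subst hb
  have := hab z
  simp_all

/-- Solutions of the sine addition law twisted by `σ` with `f`, `g` independent satisfy untwisted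
addition laws. -/
theorem addition_laws_of_not_multiple {S : Type*} [Semigroup S] (σ : S → S)
    (hσ : Function.Surjective σ) (hσmul : ∀ x y : S, σ (x * y) = σ x * σ y)
    (f g : S → ℂ) {z₀ : S} (hz₀ : f z₀ ≠ 0)
    (heq : ∀ x y : S, f (x * σ y) = f x * g y + f y * g x)
    (h : ¬ ∃ l : ℂ, ∀ x, g x = l * f x) :
    ∃ α : ℂ, (∀ x y, f (x * y) = f x * g y + f y * g x) ∧
      ∀ x y, g (x * y) = g x * g y + α * f x * f y := by
  have indep : ∀ {a b : ℂ}, (∀ x, a * f x + b * g x = 0) → a = 0 ∧ b = 0 :=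
    coeff_eq_zero_of_not_multiple hz₀ h
  have assoc : ∀ x y z, f x * g (y * z) + f (y * z) * g x =
      f x * g y * g z + f y * g x * g z + f z * g (x * σ y) := by
    intro x y z
    have h₁ := heq x (y * z)
    rw [hσmul, ← mul_assoc, heq, heq] at h₁
    linear_combination -h₁
  obtain ⟨A, B, hAB⟩ : ∃ A B : S → ℂ, ∀ x y, g (x * σ y) = f x * A y + g x * B y := by
    refine ⟨fun y => (g (y * z₀) - g y * g z₀) / f z₀,
      fun y => (f (y * z₀) - f y * g z₀) / f z₀, fun x y => ?_⟩
    field_simp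
    linear_combination -assoc x y z₀
  have mul_law : ∀ y z, g (y * z) - g y * g z - f z * A y = 0 ∧
      f (y * z) - f y * g z - f z * B y = 0 := by
    intro y z
    refine indep fun x => ?_
    linear_combination assoc x y z + f z * hAB x y
  have hB : ∀ y z, f y * (g (σ z) - g z) + f (σ z) * B y = f z * g y := by
    intro y z
    linear_combination heq y z - (mul_law y (σ z)).2
  have hA : ∀ y z, f (σ z) * A y = f y * A z + g y * (B z - g (σ z)) := by
    intro y z
    linear_combination hAB y z - (mul_law y (σ z)).1
  obtain ⟨w, rfl⟩ := hσ z₀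
  obtain ⟨β, γ, hBβ⟩ : ∃ β γ : ℂ, ∀ y, B y = β * g y + γ * f y := by
    refine ⟨f w / f (σ w), -(g (σ w) - g w) / f (σ w), fun y => ?_⟩
    field_simp
    linear_combination hB y w
  obtain ⟨α, δ, hAα⟩ : ∃ α δ : ℂ, ∀ y, A y = α * f y + δ * g y := by
    refine ⟨A w / f (σ w), (B w - g (σ w)) / f (σ w), fun y => ?_⟩
    field_simp
    linear_combination hA y w
  have hB' : ∀ z, g (σ z) - g z + f (σ z) * γ = 0 ∧ f (σ z) * β - f z = 0 := by
    intro z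
    refine indep fun y => ?_
    linear_combination hB y z - f (σ z) * hBβ y
  have hA' : ∀ z, f (σ z) * α - A z = 0 ∧ f (σ z) * δ - (B z - g (σ z)) = 0 := by
    intro z
    refine indep fun y => ?_
    linear_combination hA y z - f (σ z) * hAα y
  have hβ : β ≠ 0 := by
    rintro rfl
    apply hz₀
    linear_combination -(hB' (σ w)).2
  have hδ : δ = 0 := by
    have : α - α * β = 0 ∧ -(δ * β) = 0 := indep fun z => by
      linear_combination β * (hA' z).1 + β * hAα z - α * (hB' z).2
    simpa [hβ] using this.2
  subst hδ
  have key : -γ * β - γ = 0 ∧ β - β ^ 2 = 0 := indep fun z => by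
    linear_combination β * (hA' z).2 + β * hBβ z - β * (hB' z).1 + γ * (hB' z).2
  have hβ1 : β = 1 := by
    apply mul_left_cancel₀ hβ
    linear_combination -key.2
  subst hβ1
  have hγ : γ = 0 := by linear_combination -key.1 / 2
  subst hγ
  refine ⟨α, fun x y => ?_, fun x y => ?_⟩
  · linear_combination (mul_law x y).2 + f y * hBβ x
  · linear_combination (mul_law x y).1 + f y * hAα x

/-- If `g = l f`, the sine addition law twisted by `σ` makes `2 l f` multiplicative. -/
theorem mul_law_of_multiple {S : Type*} [Semigroup S] (σ : S → S)
    (hσ : Function.Surjective σ) (hσmul : ∀ x y : S, σ (x * y) = σ x * σ y)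
    (f : S → ℂ) {z₀ : S} (hz₀ : f z₀ ≠ 0) {l : ℂ}
    (heq : ∀ x y : S, f (x * σ y) = 2 * l * f x * f y) (x y : S) :
    f (x * y) = 2 * l * f x * f y := by
  by_cases hl : l = 0
  · obtain ⟨y, rfl⟩ := hσ y
    simp [heq, hl]
  · have h₁ := heq z₀ (x * y)
    rw [hσmul, ← mul_assoc, heq, heq] at h₁
    have h₂ : 2 * l * f z₀ ≠ 0 := by simp [hl, hz₀]
    apply mul_left_cancel₀ h₂
    linear_combination -h₁

theorem stmt_9 {S : Type*} [Semigroup S] (σ : S → S)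
    (hσbij : Function.Bijective σ)
    (hσmul : ∀ x y : S, σ (x * y) = σ x * σ y)
    (f g : S → ℂ) (hf : f ≠ 0)
    (heq : ∀ x y : S, f (x * σ y) = f x * g y + f y * g x) :
    (∀ x y : S, f (x * y) = f (y * x)) ∧
    (∀ x y : S, g (x * y) = g (y * x)) ∧
    (∀ x y z : S, f (x * y * z) = f (x * z * y)) ∧
    (∀ x y z : S, g (x * y * z) = g (x * z * y)) := by
  obtain ⟨z₀, hz₀⟩ := Function.ne_iff.mp hf
  by_cases h : ∃ l : ℂ, ∀ x, g x = l * f x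
  · obtain ⟨l, hl⟩ := h
    have hm := mul_law_of_multiple σ hσbij.2 hσmul f hz₀ (l := l) fun x y => by
      rw [heq, hl, hl]; ring
    refine ⟨fun x y => ?_, fun x y => ?_, fun x y z => ?_, fun x y z => ?_⟩ <;>
      simp only [hl, hm] <;> ring
  · obtain ⟨α, hfm, hgm⟩ := addition_laws_of_not_multiple σ hσbij.2 hσmul f g hz₀ heq h
    refine ⟨fun x y => ?_, fun x y => ?_, fun x y z => ?_, fun x y z => ?_⟩ <;>
      simp only [hfm, hgm] <;> ring
end

section
/- Let S be a semigroup and σ : S → S an automorphism. Functions f, g : S → ℂ satisfy f(x·σ(y)) = f(x)g(y) + f(y)g(x) for all x, y ∈ S if and only if they satisfy the variant equation f(σ(y)·x) = f(x)g(y) + f(y)g(x) for all x, y ∈ S. -/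
open Complex

section SineSubtraction

variable {S : Type*} [Semigroup S] {σ : S → S} {f g : S → ℂ}

/-- If `g` is a multiple of `f`, every solution `f` of `f (x * σ y) = f x * g y + f y * g x`
is central. -/
theorem central_of_eq_mul (hsurj : Function.Surjective σ)
    (hσmul : ∀ x y : S, σ (x * y) = σ x * σ y) (c : ℂ) (hc : ∀ x, g x = c * f x)
    (h : ∀ x y : S, f (x * σ y) = f x * g y + f y * g x) (x y : S) :
    f (x * y) = f (y * x) := by
  have hf : ∀ x y, f (x * σ y) = 2 * c * f x * f y := by
    intro x y
    rw [h, hc, hc]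
    ring
  by_cases hc0 : c = 0
  · have hzero : ∀ x y, f (x * y) = 0 := by
      intro x y
      obtain ⟨w, rfl⟩ := hsurj y
      rw [hf, hc0]
      ring
    rw [hzero, hzero]
  by_cases hf0 : ∀ x, f x = 0
  · rw [hf0, hf0]
  push Not at hf0
  obtain ⟨u, hu⟩ := hf0
  have hmul : ∀ y z, f (y * z) = 2 * c * f y * f z := by
    intro y z
    have h1 := hf u (y * z)
    rw [hσmul, ← mul_assoc, hf, hf] at h1
    have h2 : 2 * c * f u ≠ 0 := by simp [hc0, hu]
    apply mul_left_cancel₀ h2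
    linear_combination -h1
  rw [hmul, hmul]
  ring

/-- If `f` and `g` are linearly independent, every solution of
`f (x * σ y) = f x * g y + f y * g x` satisfies the sine addition law. -/
theorem sine_addition_of_independent (hsurj : Function.Surjective σ)
    (hσmul : ∀ x y : S, σ (x * y) = σ x * σ y)
    (hind : ∀ p q : ℂ, (∀ x, p * f x = q * g x) → p = 0 ∧ q = 0)
    (h : ∀ x y : S, f (x * σ y) = f x * g y + f y * g x) (x y : S) :
    f (x * y) = f x * g y + g x * f y := by
  obtain ⟨u, hu⟩ : ∃ u, f u ≠ 0 := by
    by_contra! hf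
    simpa using (hind 1 0 (by simp [hf])).1
  obtain ⟨w, rfl⟩ := hsurj u
  have hassoc : ∀ x y z, f x * g (y * z) + f (y * z) * g x =
      (f x * g y + f y * g x) * g z + f z * g (x * σ y) := by
    intro x y z
    rw [← h, ← h, ← h, hσmul, mul_assoc]
  obtain ⟨α, β, hg⟩ : ∃ α β : S → ℂ, ∀ x y, g (x * σ y) = f x * α y + g x * β y := by
    refine ⟨fun y => (g (y * σ w) - g y * g (σ w)) / f (σ w),
      fun y => (f (y * σ w) - f y * g (σ w)) / f (σ w), fun x y => ?_⟩
    field_simp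
    linear_combination -hassoc x y (σ w)
  have hmul : ∀ y z, g (y * z) - g y * g z - α y * f z = 0 ∧
      f y * g z + f z * β y - f (y * z) = 0 := by
    intro y z
    apply hind
    intro x
    linear_combination hassoc x y z + f z * hg x y
  obtain ⟨a, b, hβ⟩ : ∃ a b : ℂ, ∀ y, β y = a * f y + b * g y := by
    refine ⟨(g w - g (σ w)) / f (σ w), f w / f (σ w), fun y => ?_⟩
    field_simp
    linear_combination (hmul y (σ w)).2 + h y w
  have hσ : ∀ v, g v - g (σ v) - a * f (σ v) = 0 ∧ b * f (σ v) - f v = 0 := by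
    intro v
    apply hind
    intro y
    linear_combination -h y v + f (σ v) * hβ y - (hmul y (σ v)).2
  have hb : b ≠ 0 := by
    intro hb
    apply hu
    linear_combination f (σ (σ w)) * hb - (hσ (σ w)).2
  have hgσ : ∀ x y, f x * α y + g x * (a * f y + b * g y) = g x * g (σ y) + α x * f (σ y) := by
    intro x y
    linear_combination (hmul x (σ y)).1 - hg x y - g x * hβ y
  obtain ⟨c, d, hα⟩ : ∃ c d : ℂ, ∀ x, α x = c * f x + d * g x := by
    refine ⟨α w / f (σ w), (a * f w + b * g w - g (σ w)) / f (σ w), fun x => ?_⟩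
    field_simp
    linear_combination -hgσ x w
  have hασ : ∀ y, α y - c * f (σ y) = 0 ∧
      g (σ y) + d * f (σ y) - a * f y - b * g y = 0 := by
    intro y
    apply hind
    intro x
    linear_combination hgσ x y + f (σ y) * hα x
  obtain ⟨hda, hb1⟩ := hind (d - a - a * b) (b * (b - 1)) fun y => by
    linear_combination b * (hασ y).2 + b * (hσ y).1 + (a - d) * (hσ y).2
  have hb1 : b = 1 := sub_eq_zero.mp ((mul_eq_zero.mp hb1).resolve_left hb)
  subst hb1
  have hd : d = 0 := (hind 0 d fun y => by
    linear_combination hα y - (hασ y).1 - c * (hσ y).2).2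
  have ha : a = 0 := by linear_combination (hd - hda) / 2
  linear_combination -(hmul x y).2 + f y * hβ x + f y * f x * ha

/-- Every solution `f` of `f (x * σ y) = f x * g y + f y * g x` is central. -/
theorem central_of_sine_equation (hsurj : Function.Surjective σ)
    (hσmul : ∀ x y : S, σ (x * y) = σ x * σ y)
    (h : ∀ x y : S, f (x * σ y) = f x * g y + f y * g x) (x y : S) :
    f (x * y) = f (y * x) := by
  by_cases hf : ∀ x, f x = 0
  · rw [hf, hf]
  by_cases hdep : ∃ c : ℂ, ∀ x, g x = c * f x
  · obtain ⟨c, hc⟩ := hdep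
    exact central_of_eq_mul hsurj hσmul c hc h x y
  have hind : ∀ p q : ℂ, (∀ x, p * f x = q * g x) → p = 0 ∧ q = 0 := by
    intro p q hpq
    have hq : q = 0 := by
      by_contra hq
      refine hdep ⟨p / q, fun x => ?_⟩
      field_simp
      linear_combination -hpq x
    push Not at hf
    obtain ⟨u, hu⟩ := hf
    exact ⟨by simpa [hq, hu] using hpq u, hq⟩
  rw [sine_addition_of_independent hsurj hσmul hind h,
    sine_addition_of_independent hsurj hσmul hind h]
  ring

end SineSubtraction

theorem stmt_10 {S : Type*} [Semigroup S] (σ : S → S)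
    (hσbij : Function.Bijective σ)
    (hσmul : ∀ x y : S, σ (x * y) = σ x * σ y)
    (f g : S → ℂ) :
    (∀ x y : S, f (x * σ y) = f x * g y + f y * g x) ↔
    (∀ x y : S, f (σ y * x) = f x * g y + f y * g x) := by
  constructor
  · intro h x y
    rw [central_of_sine_equation hσbij.2 hσmul h, h]
  · intro h x y
    have hop := central_of_sine_equation (S := Sᵐᵒᵖ) (σ := fun x => .op (σ x.unop))
      (f := fun x => f x.unop) (g := fun x => g x.unop)
      (fun z => (hσbij.2 z.unop).imp' MulOpposite.op fun v hv => by simp [hv])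
      (fun x y => by simp [hσmul]) (fun x y => h x.unop y.unop)
      (.op (σ y)) (.op x)
    rw [← h]
    exact hop
end

section
/- Let S be a semigroup and σ : S → S an automorphism. Suppose f, g : S → ℂ satisfy f(x·σ(y)) = f(x)g(y) − f(y)g(x) for all x, y ∈ S, and suppose f and g are linearly independent. Then f ∘ σ = −f, and there exists a constant β ∈ ℂ such that g ∘ σ = g + β·f. -/
open Complex

theorem exists_det_ne_zero {S : Type*} (f g : S → ℂ)
    (hindep : ∀ a b : ℂ, (∀ x : S, a * f x + b * g x = 0) → a = 0 ∧ b = 0) :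
    ∃ p q : S, f p ≠ 0 ∧ f p * g q - f q * g p ≠ 0 := by
  have hp : ∃ p, f p ≠ 0 := by
    by_contra! h
    exact one_ne_zero (hindep 1 0 fun x => by simp [h x]).1
  obtain ⟨p, hp⟩ := hp
  by_contra! h
  exact hp (neg_eq_zero.1 (hindep (g p) (-f p) fun x => by linear_combination -h p x hp).2)

theorem stmt_11 {S : Type*} [Semigroup S] (σ : S → S)
    (hσbij : Function.Bijective σ)
    (hσmul : ∀ x y : S, σ (x * y) = σ x * σ y)
    (f g : S → ℂ)
    (heq : ∀ x y : S, f (x * σ y) = f x * g y - f y * g x)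
    (hindep : ∀ a b : ℂ, (∀ x : S, a * f x + b * g x = 0) → a = 0 ∧ b = 0) :
    (∀ x : S, f (σ x) = -f x) ∧
    (∃ β : ℂ, ∀ x : S, g (σ x) = g x + β * f x) := by
  obtain ⟨p, q, hp, hD⟩ := exists_det_ne_zero f g hindep
  obtain ⟨τ, hτσ, hστ⟩ := Function.bijective_iff_has_inverse.1 hσbij
  have hτmul (x y : S) : τ (x * y) = τ x * τ y :=
    hσbij.1 (by rw [hσmul, hστ, hστ, hστ])
  have hf (x y : S) : f (x * y) = f x * g (τ y) - f (τ y) * g x := by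
    simpa only [hστ y] using heq x (τ y)
  have hg : ∀ y, ∃ a b : ℂ, ∀ x, g (x * y) = f x * a + g x * b := by
    intro y
    refine ⟨(g (τ y) * g p - g (τ (y * σ p))) / f p,
      (f (τ (y * σ p)) - f (τ y) * g p) / f p, fun x => ?_⟩
    have h := hf (x * y) (σ p)
    rw [mul_assoc, hf x (y * σ p), hf x y, hτσ] at h
    field_simp
    linear_combination h
  choose a b hab using hg
  have hcoeff (y z : S) : g (τ (y * z)) = g (τ y) * g (τ z) - a y * f (τ z) ∧
      f (τ (y * z)) = f (τ y) * g (τ z) + b y * f (τ z) := by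
    have h := hindep (g (τ (y * z)) - (g (τ y) * g (τ z) - a y * f (τ z)))
      (-(f (τ (y * z)) - (f (τ y) * g (τ z) + b y * f (τ z)))) fun x => by
        have h := hf (x * y) z
        rw [mul_assoc, hf x (y * z), hf x y, hab] at h
        linear_combination h
    exact ⟨sub_eq_zero.1 h.1, sub_eq_zero.1 (neg_eq_zero.1 h.2)⟩
  have hE (y z : S) :
      f (τ y) * (g z - g (τ z)) + b y * f z + f (τ z) * g (τ y) = 0 := by
    have h := (hcoeff y (σ z)).2
    rw [hτmul, hf, hτσ] at h
    linear_combination -h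
  have hτ : ∃ c α : ℂ, ∀ x, f (τ x) = c * f x ∧ g (τ x) = g x + α * f x := by
    refine ⟨(b (σ p) * f q - b (σ q) * f p) / (f p * g q - f q * g p),
      (b (σ p) * g q - b (σ q) * g p) / (f p * g q - f q * g p), fun x => ?_⟩
    have h₁ := hE (σ p) x
    have h₂ := hE (σ q) x
    rw [hτσ] at h₁ h₂
    constructor
    · apply mul_right_cancel₀ hD
      rw [div_mul_eq_mul_div, div_mul_cancel₀ _ hD]
      linear_combination f p * h₂ - f q * h₁
    · apply mul_right_cancel₀ hD
      rw [add_mul, div_mul_eq_mul_div, div_mul_cancel₀ _ hD]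
      linear_combination g p * h₂ - g q * h₁
  obtain ⟨c, α, hτ⟩ := hτ
  have hb (y : S) : b y = -c * g y := by
    have h := hE y p
    rw [(hτ y).1, (hτ y).2, (hτ p).1, (hτ p).2] at h
    apply mul_right_cancel₀ hp
    linear_combination h
  have hsymm (y z : S) :
      f y * a z + c * a y * f z = (1 + c) * g y * g z + α * (1 + c) * g y * f z := by
    have h := (hcoeff y z).1
    rw [(hτ (y * z)).2, hab, hf, hb, (hτ y).2, (hτ z).1, (hτ z).2] at h
    linear_combination h
  have hc1 : c = -1 := by
    have h : (1 + c) * (f p * g q - f q * g p) ^ 2 = 0 := by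
      linear_combination -(f p ^ 2 * hsymm q q) + f p * f q * hsymm p q
        + f p * f q * hsymm q p - f q ^ 2 * hsymm p p
    have h := (mul_eq_zero.1 h).resolve_right (pow_ne_zero 2 hD)
    linear_combination h
  subst hc1
  have hfσ (x : S) : f (σ x) = -f x := by
    have h := (hτ (σ x)).1
    rw [hτσ] at h
    linear_combination h
  refine ⟨hfσ, α, fun x => ?_⟩
  have h := (hτ (σ x)).2
  rw [hτσ, hfσ] at h
  linear_combination -h
end

section
/- Let S be a semigroup and σ : S → S an automorphism. Functions f, g : S → ℂ satisfy f(x·σ(y)) = f(x)g(y) − f(y)g(x) for all x, y ∈ S if and only if one of the following holds: (1) f = 0 and g is arbitrary; (2) f is a nonzero function with f(xy) = 0 for all x, y ∈ S, and g = α·f for some α ∈ ℂ; (3) there exist a multiplicative function χ : S → ℂ with χ ∘ σ ≠ χ and χ ∘ σ ∘ σ = χ, and constants c ∈ ℂ \ {0}, c₁ ∈ ℂ, such that f = c·(χ − χ∘σ) and g = (χ + χ∘σ)/2 + c₁·(χ − χ∘σ)/2; or (4) there exist a nonzero multiplicative function χ : S → ℂ with χ ∘ σ = χ, a function φ : S →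 ℂ satisfying φ(xy) = φ(x)χ(y) + φ(y)χ(x) for all x, y ∈ S and φ ∘ σ = −φ, and a constant c₂ ∈ ℂ, such that f = φ and g = χ + c₂·φ. -/
open Complex

/-- A solution of the sine subtraction law with automorphism `σ` whose components are linearly
independent satisfies addition laws on `S`, and `σ` acts explicitly on its components. -/
theorem sine_subtraction_addition_laws {S : Type*} [Semigroup S] {σ : S → S}
    (hσ : Function.Surjective σ) (hσmul : ∀ x y : S, σ (x * y) = σ x * σ y) {f g : S → ℂ}
    (hfg : ∀ x y : S, f (x * σ y) = f x * g y - f y * g x)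
    (hind : ∀ a b : ℂ, (∀ x, a * f x + b * g x = 0) → a = 0 ∧ b = 0) :
    ∃ a b : ℂ, (∀ x, f (σ x) = -f x) ∧ (∀ x, g (σ x) = g x + a * f x) ∧
      (∀ x y, f (x * y) = f x * g y + g x * f y + a * f x * f y) ∧
      (∀ x y, g (x * y) = g x * g y - b * f x * f y) := by
  have hf : ∃ z, f z ≠ 0 := by
    by_contra! h
    exact one_ne_zero (hind 1 0 (by simp [h])).1
  obtain ⟨z₀, hz₀⟩ := hf
  have key : ∀ x y z, f z * g (x * σ y) =
      f x * (g y * g z - g (y * z)) + g x * (f (y * z) - f y * g z) := by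
    intro x y z
    have h₁ := hfg x (y * z)
    rw [hσmul, ← mul_assoc, hfg, hfg] at h₁
    linear_combination -h₁
  obtain ⟨h, k, hhk⟩ : ∃ h k : S → ℂ, ∀ x y, g (x * σ y) = f x * h y + g x * k y := by
    refine ⟨fun y => (g y * g z₀ - g (y * z₀)) / f z₀,
      fun y => (f (y * z₀) - f y * g z₀) / f z₀, fun x y => ?_⟩
    have := key x y z₀
    field_simp
    linear_combination this
  have hmul : ∀ y z, f (y * z) = f y * g z + k y * f z ∧ g (y * z) = g y * g z - h y * f z := by
    intro y z
    obtain ⟨h₁, h₂⟩ := hind (f z * h y - (g y * g z - g (y * z)))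
      (f z * k y - (f (y * z) - f y * g z)) fun x => by
        linear_combination key x y z - f z * hhk x y
    exact ⟨by linear_combination -h₂, by linear_combination h₁⟩
  have hfσ : ∀ y w, f y * (g (σ w) - g w) + k y * f (σ w) + g y * f w = 0 := fun y w => by
    linear_combination hfg y w - (hmul y (σ w)).1
  have hgσ : ∀ y w, g y * g (σ w) - h y * f (σ w) = f y * h w + g y * k w := fun y w => by
    linear_combination hhk y w - (hmul y (σ w)).2
  obtain ⟨w, hw⟩ := hσ z₀
  have hw' : f (σ w) ≠ 0 := by rwa [hw]
  obtain ⟨a, b, hk⟩ : ∃ a b : ℂ, ∀ y, k y = a * f y + b * g y := by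
    refine ⟨-(g (σ w) - g w) / f (σ w), -f w / f (σ w), fun y => ?_⟩
    field_simp
    linear_combination hfσ y w
  obtain ⟨a', b', hh⟩ : ∃ a' b' : ℂ, ∀ y, h y = a' * f y + b' * g y := by
    refine ⟨-h w / f (σ w), (g (σ w) - k w) / f (σ w), fun y => ?_⟩
    field_simp
    linear_combination -hgσ y w
  have hσf : ∀ w, g (σ w) - g w + a * f (σ w) = 0 ∧ f w + b * f (σ w) = 0 := fun w =>
    hind _ _ fun y => by linear_combination hfσ y w - f (σ w) * hk y
  have hσg : ∀ w, -a' * f (σ w) - h w = 0 ∧ g (σ w) - b' * f (σ w) - k w = 0 := fun w =>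
    hind _ _ fun y => by linear_combination hgσ y w + f (σ w) * hh y
  have hb : b ≠ 0 := by
    rintro rfl
    exact hz₀ (by simpa using (hσf z₀).2)
  have hb' : b' = 0 := by
    have := (hind (a' * b - a') (b * b') fun x => by
      linear_combination -b * (hσg x).1 - b * hh x - a' * (hσf x).2).2
    exact (mul_eq_zero.1 this).resolve_left hb
  subst hb'
  have hb₁ : b = 1 := by
    have := (hind (a - a / b) (b - 1) fun x => by
      have h₁ : f (σ x) = -f x / b := by
        field_simp
        linear_combination (hσf x).2
      have h₂ := (hσf x).1
      rw [h₁] at h₂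
      linear_combination h₂ - (hσg x).2 - hk x).2
    linear_combination this
  subst hb₁
  refine ⟨a, a', fun x => by linear_combination (hσf x).2, fun x => ?_, fun x y => ?_,
    fun x y => ?_⟩
  · linear_combination (hσf x).1 - a * (hσf x).2
  · linear_combination (hmul x y).1 + f y * hk x
  · linear_combination (hmul x y).2 - f y * hh x

theorem stmt_12 {S : Type*} [Semigroup S] (σ : S → S)
    (hσbij : Function.Bijective σ)
    (hσmul : ∀ x y : S, σ (x * y) = σ x * σ y)
    (f g : S → ℂ) :
    (∀ x y : S, f (x * σ y) = f x * g y - f y * g x) ↔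
    ((f = 0) ∨
     (f ≠ 0 ∧ (∀ x y : S, f (x * y) = 0) ∧ ∃ α : ℂ, g = fun x => α * f x) ∨
     (∃ (χ : S → ℂ) (c c₁ : ℂ), c ≠ 0 ∧
       (∀ x y : S, χ (x * y) = χ x * χ y) ∧
       (fun x => χ (σ x)) ≠ χ ∧ (∀ x : S, χ (σ (σ x)) = χ x) ∧
       f = (fun x => c * (χ x - χ (σ x))) ∧
       g = (fun x => (χ x + χ (σ x)) / 2 + c₁ * (χ x - χ (σ x)) / 2)) ∨
     (∃ (χ φ : S → ℂ) (c₂ : ℂ), χ ≠ 0 ∧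
       (∀ x y : S, χ (x * y) = χ x * χ y) ∧ (∀ x : S, χ (σ x) = χ x) ∧
       (∀ x y : S, φ (x * y) = φ x * χ y + φ y * χ x) ∧
       (∀ x : S, φ (σ x) = -φ x) ∧
       f = φ ∧ g = (fun x => χ x + c₂ * φ x))) := by
  constructor
  · intro hfg
    by_cases hf : f = 0
    · exact Or.inl hf
    by_cases hdep : ∃ α : ℂ, g = fun x => α * f x
    · refine Or.inr (Or.inl ⟨hf, fun x y => ?_, hdep⟩)
      obtain ⟨α, rfl⟩ := hdep
      obtain ⟨z, rfl⟩ := hσbij.2 y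
      rw [hfg]
      ring
    have hind : ∀ a b : ℂ, (∀ x, a * f x + b * g x = 0) → a = 0 ∧ b = 0 := by
      intro a b hab
      have hb : b = 0 := by
        by_contra hb
        refine hdep ⟨-a / b, funext fun x => ?_⟩
        field_simp
        linear_combination hab x
      obtain ⟨z, hz⟩ := Function.ne_iff.1 hf
      exact ⟨(mul_eq_zero.1 (by simpa [hb] using hab z)).resolve_right hz, hb⟩
    obtain ⟨a, b, hσf, hσg, hf_mul, hg_mul⟩ :=
      sine_subtraction_addition_laws hσbij.2 hσmul hfg hind
    obtain ⟨δ, hδ⟩ := IsAlgClosed.exists_eq_mul_self (a ^ 2 / 4 - b)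
    by_cases hδ₀ : δ = 0
    · subst hδ₀
      refine Or.inr (Or.inr (Or.inr ⟨fun x => g x + a / 2 * f x, f, -a / 2, fun h => ?_,
        fun x y => ?_, fun x => ?_, fun x y => ?_, hσf, rfl, funext fun x => by ring⟩))
      · exact one_ne_zero (hind (a / 2) 1 fun x => by
          have : g x + a / 2 * f x = 0 := congrFun h x
          linear_combination this).2
      · linear_combination hg_mul x y + a / 2 * hf_mul x y + f x * f y * hδ
      · linear_combination hσg x + a / 2 * hσf x
      · linear_combination hf_mul x y
    · have hσχ : ∀ x, g (σ x) + (a / 2 + δ) * f (σ x) = g x + (a / 2 - δ) * f x := fun x => by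
        linear_combination hσg x + (a / 2 + δ) * hσf x
      refine Or.inr (Or.inr (Or.inl ⟨fun x => g x + (a / 2 + δ) * f x, 1 / (2 * δ),
        -a / (2 * δ), by simpa using hδ₀, fun x y => ?_, fun h => hf (funext fun x => ?_),
        fun x => ?_, funext fun x => ?_, funext fun x => ?_⟩))
      · linear_combination hg_mul x y + (a / 2 + δ) * hf_mul x y + f x * f y * hδ
      · have h₁ : g (σ x) + (a / 2 + δ) * f (σ x) = g x + (a / 2 + δ) * f x := congrFun h x
        have h₂ : δ * f x = 0 := by linear_combination (hσχ x - h₁) / 2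
        exact (mul_eq_zero.1 h₂).resolve_left hδ₀
      · simp only [hσg, hσf]
        ring
      · simp only [hσχ]
        field_simp
        ring
      · simp only [hσχ]
        field_simp
        ring
  · rintro (rfl | ⟨-, hf, α, rfl⟩ | ⟨χ, c, c₁, -, hχ, -, hχσ, rfl, rfl⟩ |
      ⟨χ, φ, c₂, -, hχ, hχσ, hφ, hφσ, rfl, rfl⟩) x y
    · simp
    · rw [hf]
      ring
    · simp only [hσmul, hχ, hχσ]
      ring
    · simp only [hφ, hχσ, hφσ]
      ring
end

section
/- Let S be a semigroup and σ : S → S an automorphism. If f, g : S → ℂ satisfy f(x·σ(y)) = f(x)g(y) − f(y)g(x) for all x, y ∈ S and f ≠ 0, then both f and g are abelian; that is, f(xy) = f(yx), g(xy) = g(yx), f(xyz) = f(xzy) and g(xyz) = g(xzy) for all x, y, z ∈ S. -/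
open Complex

theorem stmt_13 {S : Type*} [Semigroup S] (σ : S → S)
    (hσbij : Function.Bijective σ)
    (hσmul : ∀ x y : S, σ (x * y) = σ x * σ y)
    (f g : S → ℂ) (hf : f ≠ 0)
    (heq : ∀ x y : S, f (x * σ y) = f x * g y - f y * g x) :
    (∀ x y : S, f (x * y) = f (y * x)) ∧
    (∀ x y : S, g (x * y) = g (y * x)) ∧
    (∀ x y z : S, f (x * y * z) = f (x * z * y)) ∧
    (∀ x y z : S, g (x * y * z) = g (x * z * y)) := by
  obtain ⟨w, hw⟩ : ∃ w, f w ≠ 0 := Function.ne_iff.mp hf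
  by_cases hdep : ∃ c : ℂ, ∀ x, g x = c * f x
  · obtain ⟨c, hc⟩ := hdep
    have hf0 : ∀ x y, f (x * y) = 0 := fun x y => by
      obtain ⟨y, rfl⟩ := hσbij.2 y
      rw [heq, hc, hc]
      ring
    simp [hc, hf0]
  have hind : ∀ p q : ℂ, (∀ x, p * f x + q * g x = 0) → p = 0 ∧ q = 0 := fun p q h => by
    have hq : q = 0 := by
      by_contra hq
      refine hdep ⟨-p / q, fun x => ?_⟩
      field_simp
      linear_combination h x
    refine ⟨?_, hq⟩
    simpa [hq, hw] using h w
  have hassoc : ∀ x y z, f z * g (x * σ y) =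
      f x * (g y * g z - g (y * z)) + g x * (f (y * z) - f y * g z) := fun x y z => by
    have h := heq x (y * z)
    rw [hσmul, ← mul_assoc, heq, heq] at h
    linear_combination -h
  obtain ⟨A, B, hAB⟩ : ∃ A B : S → ℂ, ∀ x y, g (x * σ y) = f x * A y + g x * B y := by
    refine ⟨fun y => (g y * g w - g (y * w)) / f w,
      fun y => (f (y * w) - f y * g w) / f w, fun x y => ?_⟩
    field_simp
    linear_combination hassoc x y w
  have hmul : ∀ y z, f (y * z) = f y * g z + f z * B y ∧
      g (y * z) = g y * g z - f z * A y := fun y z => by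
    have h := hind (g y * g z - g (y * z) - f z * A y) (f (y * z) - f y * g z - f z * B y)
      fun x => by linear_combination f z * hAB x y - hassoc x y z
    exact ⟨by linear_combination h.2, by linear_combination -h.1⟩
  have hB : ∀ x y, f x * (g y - g (σ y)) = f y * g x + f (σ y) * B x := fun x y => by
    linear_combination (hmul x (σ y)).1 - heq x y
  have hσw : f (σ w) ≠ 0 := fun h => hdep ⟨(g w - g (σ w)) / f w, fun x => by
    have := hB x w
    rw [h] at this
    field_simp
    linear_combination -this⟩
  obtain ⟨a, b, hab⟩ : ∃ a b : ℂ, ∀ x, B x = a * f x + b * g x := by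
    refine ⟨(g w - g (σ w)) / f (σ w), -f w / f (σ w), fun x => ?_⟩
    field_simp
    linear_combination -hB x w
  have hσ : ∀ y, g y - g (σ y) - a * f (σ y) = 0 ∧ f y + b * f (σ y) = 0 := fun y => by
    have h := hind (g y - g (σ y) - a * f (σ y)) (-(f y + b * f (σ y))) fun x => by
      linear_combination hB x y + f (σ y) * hab x
    exact ⟨h.1, neg_eq_zero.mp h.2⟩
  have hA : ∀ x y, g x * g (σ y) - f (σ y) * A x =
      f x * A y + g x * (a * f y + b * g y) := fun x y => by
    linear_combination hAB x y - (hmul x (σ y)).2 + g x * hab y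
  obtain ⟨c, d, hcd⟩ : ∃ c d : ℂ, ∀ x, A x = c * f x + d * g x := by
    refine ⟨-A w / f (σ w), (g (σ w) - a * f w - b * g w) / f (σ w), fun x => ?_⟩
    field_simp
    linear_combination -hA x w
  have hcoef : ∀ y, f (σ y) * c + (c * f y + d * g y) = 0 ∧
      g (σ y) - f (σ y) * d - a * f y - b * g y = 0 := fun y => by
    have h := hind (-(f (σ y) * c + (c * f y + d * g y)))
      (g (σ y) - f (σ y) * d - a * f y - b * g y) fun x => by
        linear_combination hA x y + f (σ y) * hcd x + f x * hcd y
    exact ⟨neg_eq_zero.mp h.1, h.2⟩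
  have hb0 : b ≠ 0 := fun h => hw (by simpa [h] using (hσ w).2)
  have hd : d = 0 := by
    have h := hind (c * b - c) (d * b) fun y => by
      linear_combination b * (hcoef y).1 - c * (hσ y).2
    exact (mul_eq_zero.mp h.2).resolve_right hb0
  have hb : b = 1 := by
    have h := hind (a - a * b) (b * (1 - b)) fun y => by
      linear_combination b * (hcoef y).2 + b * (hσ y).1 + (a + d) * (hσ y).2 - f y * hd
    exact (sub_eq_zero.mp ((mul_eq_zero.mp h.2).resolve_left hb0)).symm
  have hfmul : ∀ x y, f (x * y) = f x * g y + f y * g x + a * f x * f y := fun x y => by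
    rw [(hmul x y).1, hab, hb]
    ring
  have hgmul : ∀ x y, g (x * y) = g x * g y - c * f x * f y := fun x y => by
    rw [(hmul x y).2, hcd, hd]
    ring
  have hfc : ∀ x y, f (x * y) = f (y * x) := fun x y => by
    rw [hfmul, hfmul]
    ring
  have hgc : ∀ x y, g (x * y) = g (y * x) := fun x y => by
    rw [hgmul, hgmul]
    ring
  refine ⟨hfc, hgc, fun x y z => ?_, fun x y z => ?_⟩
  · rw [mul_assoc, mul_assoc, hfmul, hfmul x, hfc y, hgc y]
  · rw [mul_assoc, mul_assoc, hgmul, hgmul x, hfc y, hgc y]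
end

section
/- Let S be a topological semigroup and σ : S → S an automorphism. If f, g : S → ℂ satisfy g(x·σ(y)) = g(x)g(y) + f(x)f(y) for all x, y ∈ S and g is continuous, then f is continuous. -/
open Complex

theorem stmt_14 {S : Type*} [Semigroup S] [TopologicalSpace S]
    (hcont : Continuous fun p : S × S => p.1 * p.2)
    (σ : S → S)
    (hσbij : Function.Bijective σ)
    (hσmul : ∀ x y : S, σ (x * y) = σ x * σ y)
    (f g : S → ℂ)
    (heq : ∀ x y : S, g (x * σ y) = g x * g y + f x * f y)
    (hg : Continuous g) :
    Continuous f := by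
  by_cases h : ∃ y, f y ≠ 0
  · obtain ⟨y, hy⟩ := h
    have hf : f = fun x => (g (x * σ y) - g x * g y) / f y := by
      funext x
      rw [heq, add_sub_cancel_left, mul_div_cancel_right₀ _ hy]
    have hmul : Continuous fun x : S => x * σ y :=
      hcont.comp (continuous_id.prodMk continuous_const)
    rw [hf]
    exact ((hg.comp hmul).sub (hg.mul continuous_const)).div_const _
  · push Not at h
    rw [show f = fun _ => 0 from funext h]
    exact continuous_const
end

section
/- Let S be a topological semigroup and σ : S → S an automorphism. If f, g : S → ℂ satisfy f(x·σ(y)) = f(x)g(y) + f(y)g(x) for all x, y ∈ S, f ≠ 0 and f is continuous, then g is continuous. -/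
open Complex

theorem stmt_15 {S : Type*} [Semigroup S] [TopologicalSpace S]
    (hcont : Continuous fun p : S × S => p.1 * p.2)
    (σ : S → S)
    (hσbij : Function.Bijective σ)
    (hσmul : ∀ x y : S, σ (x * y) = σ x * σ y)
    (f g : S → ℂ) (hf0 : f ≠ 0)
    (heq : ∀ x y : S, f (x * σ y) = f x * g y + f y * g x)
    (hf : Continuous f) :
    Continuous g := by
  obtain ⟨y, hy⟩ := Function.ne_iff.mp hf0
  have hy' : f y ≠ 0 := hy
  have hg : g = fun x => (f (x * σ y) - f x * g y) / f y := by
    funext x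
    rw [heq x y]
    field_simp
    ring
  have hmul : Continuous fun x : S => x * σ y :=
    hcont.comp (continuous_id.prodMk continuous_const)
  rw [hg]
  exact ((hf.comp hmul).sub (hf.mul continuous_const)).div_const _
end

section
/- Let S be a topological semigroup and σ : S → S an automorphism. If f, g : S → ℂ satisfy f(x·σ(y)) = f(x)g(y) − f(y)g(x) for all x, y ∈ S, f ≠ 0 and f is continuous, then g is continuous. -/
open Complex

theorem stmt_16 {S : Type*} [Semigroup S] [TopologicalSpace S]
    (hcont : Continuous fun p : S × S => p.1 * p.2)
    (σ : S → S)
    (hσbij : Function.Bijective σ)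
    (hσmul : ∀ x y : S, σ (x * y) = σ x * σ y)
    (f g : S → ℂ) (hf0 : f ≠ 0)
    (heq : ∀ x y : S, f (x * σ y) = f x * g y - f y * g x)
    (hf : Continuous f) :
    Continuous g := by
  obtain ⟨y, hy⟩ := Function.ne_iff.mp hf0
  have hy : f y ≠ 0 := hy
  have hg : g = fun x => (f x * g y - f (x * σ y)) / f y := by
    funext x
    rw [heq x y, eq_div_iff hy]
    ring
  have hmul : Continuous fun x => x * σ y := hcont.comp (by fun_prop : Continuous fun x => (x, σ y))
  rw [hg]
  exact ((hf.mul continuous_const).sub (hf.comp hmul)).div_const _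
end

section
/- Let β ∈ ℝ with β ∉ {0, 1, −1}. Functions f, g : ℝ → ℂ satisfy g(x + β·y) = g(x)g(y) + f(x)f(y) for all x, y ∈ ℝ if and only if either f = 0 and g = 0, or there exists a constant α ∈ ℂ \ {i, −i} such that f is the constant function α/(1 + α²) and g is the constant function 1/(1 + α²). -/
open Complex

theorem stmt_17 (β : ℝ) (hβ0 : β ≠ 0) (hβ1 : β ≠ 1) (hβm1 : β ≠ -1)
    (f g : ℝ → ℂ) :
    (∀ x y : ℝ, g (x + β * y) = g x * g y + f x * f y) ↔
    ((f = 0 ∧ g = 0) ∨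
     (∃ α : ℂ, α ≠ I ∧ α ≠ -I ∧
       f = (fun _ => α / (1 + α ^ 2)) ∧ g = (fun _ => 1 / (1 + α ^ 2)))) := by
  constructor
  · intro h
    have hdet : 1 - β ^ 2 ≠ 0 := fun h0 => by
      rcases mul_eq_zero.mp (show (β - 1) * (β + 1) = 0 by linear_combination -h0) with h1 | h1
      · exact hβ1 (by linarith)
      · exact hβm1 (by linarith)
    -- The right-hand side is symmetric and `(x, y) ↦ (x + β y, y + β x)` is onto.
    have hg : ∀ u v, g u = g v := by
      intro u v
      have h1 := h ((u - β * v) / (1 - β ^ 2)) ((v - β * u) / (1 - β ^ 2))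
      have h2 := h ((v - β * u) / (1 - β ^ 2)) ((u - β * v) / (1 - β ^ 2))
      have e1 : (u - β * v) / (1 - β ^ 2) + β * ((v - β * u) / (1 - β ^ 2)) = u := by
        field_simp
        ring
      have e2 : (v - β * u) / (1 - β ^ 2) + β * ((u - β * v) / (1 - β ^ 2)) = v := by
        field_simp
        ring
      rw [e1] at h1
      rw [e2] at h2
      rw [h1, h2]
      ring
    have hprod : ∀ x y, f x * f y = g 0 - g 0 * g 0 := by
      intro x y
      have hxy := h x y
      rw [hg (x + β * y) 0, hg x 0, hg y 0] at hxy
      linear_combination -hxy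
    have hf : ∀ x, f x = f 0 := by
      intro x
      have hsq : (f x - f 0) ^ 2 = 0 := by
        linear_combination hprod x x - 2 * hprod x 0 + hprod 0 0
      exact sub_eq_zero.mp (pow_eq_zero_iff two_ne_zero |>.mp hsq)
    have h00 := hprod 0 0
    by_cases hc : g 0 = 0
    · left
      have hf0 : f 0 = 0 := by simpa [hc] using h00
      exact ⟨funext fun x => (hf x).trans hf0, funext fun x => (hg x 0).trans hc⟩
    · right
      have key : g 0 * (1 + (f 0 / g 0) ^ 2) = 1 := by
        field_simp
        linear_combination h00
      have hne : 1 + (f 0 / g 0) ^ 2 ≠ 0 := right_ne_zero_of_mul_eq_one key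
      refine ⟨f 0 / g 0, fun hI => hne ?_, fun hI => hne ?_, funext fun x => ?_,
        funext fun x => ?_⟩
      · simp [hI]
      · simp [hI]
      · rw [hf x, eq_div_iff hne]
        calc f 0 * (1 + (f 0 / g 0) ^ 2)
            = f 0 / g 0 * (g 0 * (1 + (f 0 / g 0) ^ 2)) := by field_simp
          _ = f 0 / g 0 := by rw [key, mul_one]
      · rw [hg x 0, eq_div_iff hne, key]
  · rintro (⟨rfl, rfl⟩ | ⟨α, h1, h2, rfl, rfl⟩) x y
    · simp
    · have hne : 1 + α ^ 2 ≠ 0 := fun h0 => by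
        rcases mul_eq_zero.mp
          (show (α - I) * (α + I) = 0 by linear_combination h0 - I_sq) with h3 | h3
        · exact h1 (sub_eq_zero.mp h3)
        · exact h2 (eq_neg_of_add_eq_zero_left h3)
      field_simp
end

section
/- Let β ∈ ℝ with β ∉ {0, 1, −1}. Functions f, g : ℝ → ℂ satisfy f(x + β·y) = f(x)g(y) + f(y)g(x) for all x, y ∈ ℝ if and only if either f = 0 (with g arbitrary), or there exists a constant α ∈ ℂ \ {0} such that f is the constant function 1/(2α) and g is the constant function 1/2. -/
open Complex

theorem stmt_18 (β : ℝ) (hβ0 : β ≠ 0) (hβ1 : β ≠ 1) (hβm1 : β ≠ -1)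
    (f g : ℝ → ℂ) :
    (∀ x y : ℝ, f (x + β * y) = f x * g y + f y * g x) ↔
    ((f = 0) ∨
     (∃ α : ℂ, α ≠ 0 ∧ f = (fun _ => 1 / (2 * α)) ∧ g = (fun _ => (1 : ℂ) / 2))) := by
  constructor
  · intro h
    have hsymm : ∀ x y : ℝ, f (x + β * y) = f (y + β * x) := fun x y => by
      rw [h x y, h y x, add_comm]
    have hdet : 1 - β ^ 2 ≠ 0 := by
      have : 1 - β ^ 2 = (1 - β) * (1 + β) := by ring
      rw [this]
      exact mul_ne_zero (sub_ne_zero.mpr hβ1.symm) fun h' => hβm1 (by linarith)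
    have hconst : ∀ t, f t = f 0 := fun t => by
      have key := hsymm (t / (1 - β ^ 2)) (-β * (t / (1 - β ^ 2)))
      have h1 : t / (1 - β ^ 2) + β * (-β * (t / (1 - β ^ 2))) = t := by
        field_simp
        ring
      have h2 : -β * (t / (1 - β ^ 2)) + β * (t / (1 - β ^ 2)) = 0 := by ring
      rwa [h1, h2] at key
    by_cases hc : f 0 = 0
    · exact Or.inl (funext fun t => by simp [hconst t, hc])
    · refine Or.inr ⟨1 / (2 * f 0), by simpa using hc, funext fun t => ?_, funext fun t => ?_⟩
      · rw [hconst t]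
        field_simp
      · have key := h t t
        rw [hconst (t + β * t), hconst t] at key
        apply mul_left_cancel₀ hc
        linear_combination -key / 2
  · rintro (rfl | ⟨α, hα, rfl, rfl⟩) x y
    · simp
    · ring
end
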